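/- arXiv:2109.08531 — 8 statements merged into one kernel-verified Lean document; each statement's English description precedes it below -/
import Mathlib

section
/- Let n ≥ 1. For data (ν, a, b, ω) with ν ∈ ℝ, a, b ∈ ℝⁿ and ω a real skew-symmetric n×n matrix, let F(ν,a,b,ω) be the endomorphism of ℝ^{n+2} given, with respect to the splitting span{e₀} ⊕ span{e₁} ⊕ span{e₂,…,e_{n+1}}, by the block matrix with rows (0, −ν, −aᵀ+bᵀ/2), (−ν, 0, −aᵀ−bᵀ/2), (−a+b/2, a+b/2, −ω), and let Y_{(ν,a,b,ω)}(X) = b + νX + ⟨a,X⟩X − (|X|²/2)a − ωX be the associated vector field on ℝⁿ. Then: (i) each F(ν,a,b,ω) is η-skew-symmetric; (ii) for any two data sets, the commutator F(ν₁,a₁,b₁,ω₁)∘F(ν₂,a₂,b₂,ω₂) − F(ν₂,a₂,b₂,ω₂)∘F(ν₁,a₁,b₁,ω₁) equals F(ν₃,a₃,b₃,ω₃) for unique data (ν₃,a₃,b₃,ω₃), and the associated vector field Y_{(ν₃,a₃,b₃,ω₃)} equals −[Y₁,Y₂], where [Y₁,Y₂](x) := DY₂(x)[Y₁(x)] − DY₁(x)[Y₂(x)]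 is the Lie bracket of the vector fields Y_k := Y_{(ν_k,a_k,b_k,ω_k)}. -/
open Matrix

/-- The Minkowski bilinear form of signature `(1, n+1)` on `ℝ^{n+2}`. -/
noncomputable def mink (n : ℕ) (u v : Fin (n + 2) → ℝ) : ℝ :=
  -(u 0 * v 0) + ∑ k : Fin (n + 1), u k.succ * v k.succ

/-- The skew-symmetric endomorphism of `ℝ^{n+2}` associated to the data `(ν, a, b, ω)`,
given by the block matrix with rows `(0, −ν, −aᵀ+bᵀ/2)`, `(−ν, 0, −aᵀ−bᵀ/2)`,
`(−a+b/2, a+b/2, −ω)` with respect to the splitting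
`span{e₀} ⊕ span{e₁} ⊕ span{e₂,…,e_{n+1}}`. -/
noncomputable def Fmat (n : ℕ) (ν : ℝ) (a b : Fin n → ℝ) (ω : Matrix (Fin n) (Fin n) ℝ) :
    Matrix (Fin (n + 2)) (Fin (n + 2)) ℝ :=
  Matrix.of fun i j =>
    if hi : (i : ℕ) < 2 then
      if hj : (j : ℕ) < 2 then (if i = j then 0 else -ν)
      else
        if (i : ℕ) = 0 then
          -a ⟨(j : ℕ) - 2, by have := j.isLt; omega⟩
            + b ⟨(j : ℕ) - 2, by have := j.isLt; omega⟩ / 2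
        else
          -a ⟨(j : ℕ) - 2, by have := j.isLt; omega⟩
            - b ⟨(j : ℕ) - 2, by have := j.isLt; omega⟩ / 2
    else
      if hj : (j : ℕ) < 2 then
        if (j : ℕ) = 0 then
          -a ⟨(i : ℕ) - 2, by have := i.isLt; omega⟩
            + b ⟨(i : ℕ) - 2, by have := i.isLt; omega⟩ / 2
        else
          a ⟨(i : ℕ) - 2, by have := i.isLt; omega⟩
            + b ⟨(i : ℕ) - 2, by have := i.isLt; omega⟩ / 2
      else -ω ⟨(i : ℕ) - 2, by have := i.isLt; omega⟩ ⟨(j : ℕ) - 2, by have := j.isLt; omega⟩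

/-- The conformal Killing vector field of `ℝⁿ` associated to the data `(ν, a, b, ω)`:
`Y(X) = b + νX + ⟨a,X⟩X − (|X|²/2)a − ωX`. -/
noncomputable def Yf (n : ℕ) (ν : ℝ) (a b : Fin n → ℝ) (ω : Matrix (Fin n) (Fin n) ℝ) :
    (Fin n → ℝ) → (Fin n → ℝ) :=
  fun X i => b i + ν * X i + (∑ j, a j * X j) * X i - ((∑ j, X j ^ 2) / 2) * a i
    - ω.mulVec X i

theorem Fmat_zero_zero (n : ℕ) (ν : ℝ) (a b : Fin n → ℝ) (ω : Matrix (Fin n) (Fin n) ℝ) :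
    Fmat n ν a b ω 0 0 = 0 := by
  simp [Fmat]

theorem Fmat_zero_one (n : ℕ) (ν : ℝ) (a b : Fin n → ℝ) (ω : Matrix (Fin n) (Fin n) ℝ) :
    Fmat n ν a b ω 0 1 = -ν := by
  simp [Fmat]

theorem Fmat_one_zero (n : ℕ) (ν : ℝ) (a b : Fin n → ℝ) (ω : Matrix (Fin n) (Fin n) ℝ) :
    Fmat n ν a b ω 1 0 = -ν := by
  simp [Fmat]

theorem Fmat_one_one (n : ℕ) (ν : ℝ) (a b : Fin n → ℝ) (ω : Matrix (Fin n) (Fin n) ℝ) :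
    Fmat n ν a b ω 1 1 = 0 := by
  simp [Fmat]

theorem Fmat_zero_succ_succ (n : ℕ) (ν : ℝ) (a b : Fin n → ℝ) (ω : Matrix (Fin n) (Fin n) ℝ)
    (j : Fin n) : Fmat n ν a b ω 0 j.succ.succ = -a j + b j / 2 := by
  simp [Fmat]

theorem Fmat_one_succ_succ (n : ℕ) (ν : ℝ) (a b : Fin n → ℝ) (ω : Matrix (Fin n) (Fin n) ℝ)
    (j : Fin n) : Fmat n ν a b ω 1 j.succ.succ = -a j - b j / 2 := by
  simp [Fmat]

theorem Fmat_succ_succ_zero (n : ℕ) (ν : ℝ) (a b : Fin n → ℝ) (ω : Matrix (Fin n) (Fin n) ℝ)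
    (i : Fin n) : Fmat n ν a b ω i.succ.succ 0 = -a i + b i / 2 := by
  simp [Fmat]

theorem Fmat_succ_succ_one (n : ℕ) (ν : ℝ) (a b : Fin n → ℝ) (ω : Matrix (Fin n) (Fin n) ℝ)
    (i : Fin n) : Fmat n ν a b ω i.succ.succ 1 = a i + b i / 2 := by
  simp [Fmat]

theorem Fmat_succ_succ (n : ℕ) (ν : ℝ) (a b : Fin n → ℝ) (ω : Matrix (Fin n) (Fin n) ℝ)
    (i j : Fin n) : Fmat n ν a b ω i.succ.succ j.succ.succ = -ω i j := by
  simp [Fmat]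

/-- The data `(ν, a, b, ω)` can be read off from the entries of `Fmat n ν a b ω`. -/
theorem Fmat_inj {n : ℕ} {ν ν' : ℝ} {a b a' b' : Fin n → ℝ} {ω ω' : Matrix (Fin n) (Fin n) ℝ}
    (h : Fmat n ν a b ω = Fmat n ν' a' b' ω') : ν = ν' ∧ a = a' ∧ b = b' ∧ ω = ω' := by
  have entry (i j) := congrFun (congrFun h i) j
  have h₀ (j : Fin n) := entry 0 j.succ.succ
  have h₁ (j : Fin n) := entry 1 j.succ.succ
  simp only [Fmat_zero_succ_succ, Fmat_one_succ_succ] at h₀ h₁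
  refine ⟨?_, ?_, ?_, ?_⟩
  · simpa [Fmat_zero_one] using entry 0 1
  · ext j
    linarith [h₀ j, h₁ j]
  · ext j
    linarith [h₀ j, h₁ j]
  · ext i j
    simpa [Fmat_succ_succ] using entry i.succ.succ j.succ.succ

/-- An endomorphism `M` is `mink`-skew as soon as the matrix `diag(-1, 1, …, 1) * M` is
skew-symmetric. -/
theorem mink_mulVec_add_eq_zero {n : ℕ} {M : Matrix (Fin (n + 2)) (Fin (n + 2)) ℝ}
    (h₀₀ : M 0 0 = 0) (h₀ : ∀ k : Fin (n + 1), M 0 k.succ = M k.succ 0)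
    (h : ∀ k l : Fin (n + 1), M k.succ l.succ = -M l.succ k.succ) (u v : Fin (n + 2) → ℝ) :
    mink n (M *ᵥ u) v + mink n u (M *ᵥ v) = 0 := by
  have hskew : ∑ k : Fin (n + 1), (∑ l : Fin (n + 1), M k.succ l.succ * u l.succ) * v k.succ
      + ∑ k : Fin (n + 1), u k.succ * ∑ l : Fin (n + 1), M k.succ l.succ * v l.succ = 0 := by
    simp only [Finset.sum_mul, Finset.mul_sum]
    rw [Finset.sum_comm, ← Finset.sum_add_distrib]
    refine Finset.sum_eq_zero fun k _ => ?_
    rw [← Finset.sum_add_distrib]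
    refine Finset.sum_eq_zero fun l _ => ?_
    rw [h l k]
    ring
  have hcol (w z : Fin (n + 2) → ℝ) : ∑ k : Fin (n + 1), M k.succ 0 * w 0 * z k.succ
      = w 0 * ∑ k : Fin (n + 1), M k.succ 0 * z k.succ := by
    rw [Finset.mul_sum]
    exact Finset.sum_congr rfl fun k _ => by ring
  have hcol' : ∑ k : Fin (n + 1), u k.succ * (M k.succ 0 * v 0)
      = v 0 * ∑ k : Fin (n + 1), M k.succ 0 * u k.succ := by
    rw [Finset.mul_sum]
    exact Finset.sum_congr rfl fun k _ => by ring
  simp only [mink, mulVec, dotProduct, Fin.sum_univ_succ (n := n + 1), h₀₀, h₀, add_mul, mul_add,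
    Finset.sum_add_distrib, hcol, hcol']
  linear_combination hskew

theorem apply_swap_of_transpose_eq_neg {n : ℕ} {ω : Matrix (Fin n) (Fin n) ℝ} (hω : ωᵀ = -ω)
    (i j : Fin n) : ω i j = -ω j i :=
  congrFun (congrFun hω j) i

theorem mink_Fmat_skew {n : ℕ} (ν : ℝ) (a b : Fin n → ℝ) {ω : Matrix (Fin n) (Fin n) ℝ}
    (hω : ωᵀ = -ω) (u v : Fin (n + 2) → ℝ) :
    mink n (Fmat n ν a b ω *ᵥ u) v + mink n u (Fmat n ν a b ω *ᵥ v) = 0 := by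
  refine mink_mulVec_add_eq_zero (Fmat_zero_zero ..) (fun k => ?_) (fun k l => ?_) u v
  · cases k using Fin.cases with
    | zero => simp [Fmat_zero_one, Fmat_one_zero]
    | succ k => rw [Fmat_zero_succ_succ, Fmat_succ_succ_zero]
  · cases k using Fin.cases with
    | zero =>
      cases l using Fin.cases with
      | zero => simp [Fmat_one_one]
      | succ l =>
        rw [Fin.succ_zero_eq_one, Fmat_one_succ_succ, Fmat_succ_succ_one]
        ring
    | succ k =>
      cases l using Fin.cases with
      | zero =>
        rw [Fin.succ_zero_eq_one, Fmat_one_succ_succ, Fmat_succ_succ_one]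
        ring
      | succ l => rw [Fmat_succ_succ, Fmat_succ_succ, apply_swap_of_transpose_eq_neg hω k l]

theorem mulVec_dotProduct_of_transpose_eq_neg {n : ℕ} {ω : Matrix (Fin n) (Fin n) ℝ}
    (hω : ωᵀ = -ω) (u v : Fin n → ℝ) : (ω *ᵥ u) ⬝ᵥ v = -(u ⬝ᵥ (ω *ᵥ v)) := by
  rw [dotProduct_mulVec, ← mulVec_transpose, hω, neg_mulVec, neg_dotProduct, neg_neg]

/-- The rotational part of the data of the commutator of two matrices `Fmat`. -/
noncomputable def commRot {n : ℕ} (a₁ b₁ a₂ b₂ : Fin n → ℝ) (ω₁ ω₂ : Matrix (Fin n) (Fin n) ℝ) :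
    Matrix (Fin n) (Fin n) ℝ :=
  ω₂ * ω₁ - ω₁ * ω₂ + vecMulVec a₁ b₂ + vecMulVec b₁ a₂ - vecMulVec a₂ b₁ - vecMulVec b₂ a₁

theorem commRot_transpose {n : ℕ} (a₁ b₁ a₂ b₂ : Fin n → ℝ) {ω₁ ω₂ : Matrix (Fin n) (Fin n) ℝ}
    (h₁ : ω₁ᵀ = -ω₁) (h₂ : ω₂ᵀ = -ω₂) :
    (commRot a₁ b₁ a₂ b₂ ω₁ ω₂)ᵀ = -commRot a₁ b₁ a₂ b₂ ω₁ ω₂ := by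
  simp only [commRot, transpose_add, transpose_sub, transpose_mul, transpose_vecMulVec, h₁, h₂,
    neg_mul_neg]
  abel

theorem Fmat_commutator {n : ℕ} (ν₁ ν₂ : ℝ) (a₁ b₁ a₂ b₂ : Fin n → ℝ)
    {ω₁ ω₂ : Matrix (Fin n) (Fin n) ℝ} (h₁ : ω₁ᵀ = -ω₁) (h₂ : ω₂ᵀ = -ω₂) :
    Fmat n (a₁ ⬝ᵥ b₂ - a₂ ⬝ᵥ b₁)
        (ν₂ • a₁ - ν₁ • a₂ + ω₂ *ᵥ a₁ - ω₁ *ᵥ a₂)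
        (ν₁ • b₂ - ν₂ • b₁ + ω₂ *ᵥ b₁ - ω₁ *ᵥ b₂)
        (commRot a₁ b₁ a₂ b₂ ω₁ ω₂)
      = Fmat n ν₁ a₁ b₁ ω₁ * Fmat n ν₂ a₂ b₂ ω₂
        - Fmat n ν₂ a₂ b₂ ω₂ * Fmat n ν₁ a₁ b₁ ω₁ := by
  have row {ω : Matrix (Fin n) (Fin n) ℝ} (hω : ωᵀ = -ω) (c : Fin n → ℝ) (j : Fin n) :
      ∑ k, c k * -ω k j = (ω *ᵥ c) j := by
    simp only [mulVec, dotProduct, ← apply_swap_of_transpose_eq_neg hω j, mul_comm]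
  have col (ω : Matrix (Fin n) (Fin n) ℝ) (c : Fin n → ℝ) (i : Fin n) :
      ∑ k, -ω i k * c k = -(ω *ᵥ c) i := by
    simp [mulVec, dotProduct]
  have vadd (a b : Fin n → ℝ) : (fun k => a k + b k / 2) = a + (1 / 2 : ℝ) • b := by
    ext k
    simp [div_eq_inv_mul]
  have vnegadd (a b : Fin n → ℝ) : (fun k => -a k + b k / 2) = -a + (1 / 2 : ℝ) • b := by
    ext k
    simp [div_eq_inv_mul]
  have vnegsub (a b : Fin n → ℝ) : (fun k => -a k - b k / 2) = -a - (1 / 2 : ℝ) • b := by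
    ext k
    simp [div_eq_inv_mul]
  have dot (u v : Fin n → ℝ) : ∑ k, u k * v k = u ⬝ᵥ v := rfl
  ext i j
  simp only [Matrix.sub_apply, Matrix.mul_apply, Fin.sum_univ_succ, Fin.succ_zero_eq_one]
  cases i using Fin.cases with
  | zero =>
    cases j using Fin.cases with
    | zero =>
      simp only [Fmat_zero_zero, Fmat_zero_one, Fmat_one_zero, Fmat_zero_succ_succ,
        Fmat_succ_succ_zero, mul_comm (-a₂ _ + b₂ _ / 2)]
      ring
    | succ j =>
      cases j using Fin.cases with
      | zero =>
        simp only [Fin.succ_zero_eq_one, Fmat_zero_zero, Fmat_zero_one, Fmat_one_one,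
          Fmat_zero_succ_succ, Fmat_succ_succ_one]
        rw [dot (fun k => -a₁ k + b₁ k / 2) (fun k => a₂ k + b₂ k / 2),
          dot (fun k => -a₂ k + b₂ k / 2) (fun k => a₁ k + b₁ k / 2)]
        rw [vnegadd, vadd, vnegadd, vadd]
        simp only [dotProduct_add, dotProduct_smul, add_dotProduct, neg_dotProduct,
          smul_dotProduct, smul_eq_mul]
        rw [dotProduct_comm a₂ a₁, dotProduct_comm b₂ b₁, dotProduct_comm b₁ a₂,
          dotProduct_comm b₂ a₁]
        ring
      | succ j =>
        simp only [Fmat_zero_zero, Fmat_zero_one, Fmat_one_succ_succ, Fmat_zero_succ_succ,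
          Fmat_succ_succ]
        rw [row h₂ (fun k => -a₁ k + b₁ k / 2), row h₁ (fun k => -a₂ k + b₂ k / 2)]
        simp only [vnegadd, mulVec_add, mulVec_neg, mulVec_smul, Pi.add_apply, Pi.sub_apply,
          Pi.neg_apply, Pi.smul_apply, smul_eq_mul]
        ring
  | succ i =>
    cases i using Fin.cases with
    | zero =>
      cases j using Fin.cases with
      | zero =>
        simp only [Fin.succ_zero_eq_one, Fmat_zero_zero, Fmat_one_zero, Fmat_one_one,
          Fmat_one_succ_succ, Fmat_succ_succ_zero]
        rw [dot (fun k => -a₁ k - b₁ k / 2) (fun k => -a₂ k + b₂ k / 2),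
          dot (fun k => -a₂ k - b₂ k / 2) (fun k => -a₁ k + b₁ k / 2)]
        simp only [vnegsub, vnegadd, dotProduct_add, dotProduct_neg, dotProduct_smul,
          sub_dotProduct, neg_dotProduct, smul_dotProduct, smul_eq_mul]
        rw [dotProduct_comm a₂ a₁, dotProduct_comm b₂ b₁, dotProduct_comm b₁ a₂,
          dotProduct_comm b₂ a₁]
        ring
      | succ j =>
        cases j using Fin.cases with
        | zero =>
          simp only [Fin.succ_zero_eq_one, Fmat_zero_one, Fmat_one_zero, Fmat_one_one,
            Fmat_one_succ_succ, Fmat_succ_succ_one]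
          have (k : Fin n) : (-a₂ k - b₂ k / 2) * (a₁ k + b₁ k / 2)
              = (-a₁ k - b₁ k / 2) * (a₂ k + b₂ k / 2) := by ring
          simp only [this]
          ring
        | succ j =>
          simp only [Fin.succ_zero_eq_one, Fmat_one_zero, Fmat_one_one, Fmat_one_succ_succ,
            Fmat_zero_succ_succ, Fmat_succ_succ]
          rw [row h₂ (fun k => -a₁ k - b₁ k / 2), row h₁ (fun k => -a₂ k - b₂ k / 2)]
          simp only [vnegsub, mulVec_sub, mulVec_neg, mulVec_smul, Pi.add_apply, Pi.sub_apply,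
            Pi.neg_apply, Pi.smul_apply, smul_eq_mul]
          ring
    | succ i =>
      cases j using Fin.cases with
      | zero =>
        simp only [Fmat_zero_zero, Fmat_one_zero, Fmat_succ_succ_zero, Fmat_succ_succ_one,
          Fmat_succ_succ]
        rw [col ω₁ (fun k => -a₂ k + b₂ k / 2), col ω₂ (fun k => -a₁ k + b₁ k / 2)]
        simp only [vnegadd, mulVec_add, mulVec_neg, mulVec_smul, Pi.add_apply, Pi.sub_apply,
          Pi.neg_apply, Pi.smul_apply, smul_eq_mul]
        ring
      | succ j =>
        cases j using Fin.cases with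
        | zero =>
          simp only [Fin.succ_zero_eq_one, Fmat_zero_one, Fmat_one_one, Fmat_succ_succ_zero,
            Fmat_succ_succ_one, Fmat_succ_succ]
          rw [col ω₁ (fun k => a₂ k + b₂ k / 2), col ω₂ (fun k => a₁ k + b₁ k / 2)]
          simp only [vadd, mulVec_add, mulVec_smul, Pi.add_apply, Pi.sub_apply, Pi.smul_apply,
            smul_eq_mul]
          ring
        | succ j =>
          simp only [Fmat_zero_succ_succ, Fmat_one_succ_succ, Fmat_succ_succ_zero,
            Fmat_succ_succ_one, Fmat_succ_succ, neg_mul_neg, commRot, Matrix.add_apply,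
            Matrix.sub_apply, Matrix.mul_apply, vecMulVec_apply]
          ring

theorem fderiv_Yf_apply {n : ℕ} (ν : ℝ) (a b : Fin n → ℝ) (ω : Matrix (Fin n) (Fin n) ℝ)
    (x v : Fin n → ℝ) (i : Fin n) :
    fderiv ℝ (fun z => Yf n ν a b ω z i) x v
      = ν * v i + (a ⬝ᵥ v) * x i + (a ⬝ᵥ x) * v i - (x ⬝ᵥ v) * a i - (ω *ᵥ v) i := by
  have hp (j : Fin n) : HasFDerivAt (fun z : Fin n → ℝ => z j)
      (ContinuousLinearMap.proj j : (Fin n → ℝ) →L[ℝ] ℝ) x := hasFDerivAt_apply j x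
  have hlin (c : Fin n → ℝ) := HasFDerivAt.fun_sum (u := Finset.univ)
    fun j _ => (hp j).const_mul (c j)
  have hsq := HasFDerivAt.fun_sum (u := Finset.univ) fun j _ => (hp j).pow 2
  have h := (((((hp i).const_mul ν).const_add (b i)).add ((hlin a).mul (hp i))).sub
    ((hsq.mul_const (2⁻¹ : ℝ)).mul_const (a i))).sub (hlin (ω i))
  have h' : HasFDerivAt (fun z => Yf n ν a b ω z i) _ x := h
  rw [h'.fderiv]
  simp [dotProduct, mulVec]
  simp only [mul_assoc (2 : ℝ), ← Finset.mul_sum]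
  ring

theorem Yf_apply {n : ℕ} (ν : ℝ) (a b : Fin n → ℝ) (ω : Matrix (Fin n) (Fin n) ℝ)
    (x : Fin n → ℝ) :
    Yf n ν a b ω x = b + ν • x + (a ⬝ᵥ x) • x - ((x ⬝ᵥ x) / 2) • a - ω *ᵥ x := by
  ext i
  simp [Yf, dotProduct, sq]

theorem Yf_commutator {n : ℕ} (ν₁ ν₂ : ℝ) (a₁ b₁ a₂ b₂ : Fin n → ℝ)
    {ω₁ ω₂ : Matrix (Fin n) (Fin n) ℝ} (h₁ : ω₁ᵀ = -ω₁) (h₂ : ω₂ᵀ = -ω₂) (x : Fin n → ℝ)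
    (i : Fin n) :
    Yf n (a₁ ⬝ᵥ b₂ - a₂ ⬝ᵥ b₁)
        (ν₂ • a₁ - ν₁ • a₂ + ω₂ *ᵥ a₁ - ω₁ *ᵥ a₂)
        (ν₁ • b₂ - ν₂ • b₁ + ω₂ *ᵥ b₁ - ω₁ *ᵥ b₂)
        (commRot a₁ b₁ a₂ b₂ ω₁ ω₂) x i
      = -(fderiv ℝ (fun z => Yf n ν₂ a₂ b₂ ω₂ z i) x (Yf n ν₁ a₁ b₁ ω₁ x)
          - fderiv ℝ (fun z => Yf n ν₁ a₁ b₁ ω₁ z i) x (Yf n ν₂ a₂ b₂ ω₂ x)) := by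
  have isotropic {ω : Matrix (Fin n) (Fin n) ℝ} (hω : ωᵀ = -ω) : x ⬝ᵥ (ω *ᵥ x) = 0 := by
    have := mulVec_dotProduct_of_transpose_eq_neg hω x x
    rw [dotProduct_comm] at this
    linarith
  have rot : commRot a₁ b₁ a₂ b₂ ω₁ ω₂ *ᵥ x = ω₂ *ᵥ (ω₁ *ᵥ x) - ω₁ *ᵥ (ω₂ *ᵥ x)
      + (b₂ ⬝ᵥ x) • a₁ + (a₂ ⬝ᵥ x) • b₁ - (b₁ ⬝ᵥ x) • a₂ - (a₁ ⬝ᵥ x) • b₂ := by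
    simp [commRot, add_mulVec, sub_mulVec, vecMulVec_mulVec]
  rw [fderiv_Yf_apply, fderiv_Yf_apply]
  simp only [Yf_apply, rot, dotProduct_add, dotProduct_sub, dotProduct_smul,
    add_dotProduct, sub_dotProduct, smul_dotProduct, mulVec_add, mulVec_sub, mulVec_smul,
    mulVec_dotProduct_of_transpose_eq_neg h₁, mulVec_dotProduct_of_transpose_eq_neg h₂,
    isotropic h₁, isotropic h₂, Pi.add_apply, Pi.sub_apply, Pi.smul_apply, smul_eq_mul]
  rw [dotProduct_comm x a₁, dotProduct_comm x a₂, dotProduct_comm x b₁, dotProduct_comm x b₂,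
    dotProduct_comm a₂ a₁]
  ring

/-- (i) every `Fmat ν a b ω` (with `ω` skew) is `η`-skew-symmetric;
(ii) the commutator of two such endomorphisms is `Fmat ν₃ a₃ b₃ ω₃` for unique data,
and the associated vector field is minus the Lie bracket `[Y₁, Y₂]`. -/
theorem stmt1 (n : ℕ) (hn : 1 ≤ n) :
    (∀ (ν : ℝ) (a b : Fin n → ℝ) (ω : Matrix (Fin n) (Fin n) ℝ), ωᵀ = -ω →
      ∀ u v, mink n ((Fmat n ν a b ω).mulVec u) v
        + mink n u ((Fmat n ν a b ω).mulVec v) = 0)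
    ∧
    (∀ (ν₁ ν₂ : ℝ) (a₁ b₁ a₂ b₂ : Fin n → ℝ) (ω₁ ω₂ : Matrix (Fin n) (Fin n) ℝ),
      ω₁ᵀ = -ω₁ → ω₂ᵀ = -ω₂ →
      (∃! d : ℝ × (Fin n → ℝ) × (Fin n → ℝ) × Matrix (Fin n) (Fin n) ℝ,
        (d.2.2.2)ᵀ = -d.2.2.2 ∧
        Fmat n d.1 d.2.1 d.2.2.1 d.2.2.2
          = Fmat n ν₁ a₁ b₁ ω₁ * Fmat n ν₂ a₂ b₂ ω₂
            - Fmat n ν₂ a₂ b₂ ω₂ * Fmat n ν₁ a₁ b₁ ω₁)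
      ∧
      (∀ (ν₃ : ℝ) (a₃ b₃ : Fin n → ℝ) (ω₃ : Matrix (Fin n) (Fin n) ℝ),
        ω₃ᵀ = -ω₃ →
        Fmat n ν₃ a₃ b₃ ω₃
          = Fmat n ν₁ a₁ b₁ ω₁ * Fmat n ν₂ a₂ b₂ ω₂
            - Fmat n ν₂ a₂ b₂ ω₂ * Fmat n ν₁ a₁ b₁ ω₁ →
        ∀ x : Fin n → ℝ, Yf n ν₃ a₃ b₃ ω₃ x = fun i =>
          -(fderiv ℝ (fun z => Yf n ν₂ a₂ b₂ ω₂ z i) x (Yf n ν₁ a₁ b₁ ω₁ x)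
            - fderiv ℝ (fun z => Yf n ν₁ a₁ b₁ ω₁ z i) x (Yf n ν₂ a₂ b₂ ω₂ x)))) := by
  refine ⟨fun ν a b ω hω => mink_Fmat_skew ν a b hω, fun ν₁ ν₂ a₁ b₁ a₂ b₂ ω₁ ω₂ h₁ h₂ => ?_⟩
  have hcomm := Fmat_commutator ν₁ ν₂ a₁ b₁ a₂ b₂ h₁ h₂
  refine ⟨⟨(_, _, _, _), ⟨commRot_transpose a₁ b₁ a₂ b₂ h₁ h₂, hcomm⟩, ?_⟩, ?_⟩
  · rintro ⟨ν, a, b, ω⟩ ⟨-, hF⟩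
    obtain ⟨rfl, rfl, rfl, rfl⟩ := Fmat_inj (hF.trans hcomm.symm)
    rfl
  · intro ν₃ a₃ b₃ ω₃ _ hF x
    obtain ⟨rfl, rfl, rfl, rfl⟩ := Fmat_inj (hF.trans hcomm.symm)
    exact funext (Yf_commutator ν₁ ν₂ a₁ b₁ a₂ b₂ h₁ h₂ x)
end

section
/- Let n ≥ 1 and let F be an η-skew-symmetric endomorphism of ℝ^{n+2}. Set q := ⌊n/2⌋. Then there exists a monic real polynomial Q of degree q+1 which splits over ℝ (it has q+1 real roots counted with multiplicity) such that the characteristic polynomial of −F² equals Q(X)² when n is even, and equals X·Q(X)² when n is odd; moreover at most one element of the multiset of roots of Q (counted with multiplicity) is negative. -/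
open Polynomial

/-- For an endomorphism skew with respect to a sesquilinear form, the generalized eigenspaces
of `a` and `b` are orthogonal unless `conj a + b = 0`. -/
theorem Module.End.sesq_eq_zero_of_mem_maxGenEigenspace {V : Type*} [AddCommGroup V] [Module ℂ V]
    (h : V →ₗ⋆[ℂ] V →ₗ[ℂ] ℂ) (T : Module.End ℂ V) (hT : ∀ u v, h (T u) v + h u (T v) = 0)
    {a b : ℂ} (hab : (starRingEnd ℂ) a + b ≠ 0) {u v : V}
    (hu : u ∈ T.maxGenEigenspace a) (hv : v ∈ T.maxGenEigenspace b) : h u v = 0 := by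
  obtain ⟨k, hk⟩ := (T.mem_maxGenEigenspace a u).1 hu
  obtain ⟨l, hl⟩ := (T.mem_maxGenEigenspace b v).1 hv
  clear hu hv
  induction k generalizing l u v with
  | zero => simp_all
  | succ k ihk =>
    induction l generalizing v with
    | zero => simp_all
    | succ l ihl =>
      have h₁ := ihk (u := (T - a • 1) u) (v := v) (by rwa [pow_succ] at hk) (l + 1) hl
      have h₂ := ihl (v := (T - b • 1) v) (by rwa [pow_succ] at hl)
      have h₃ := hT u v
      simp only [LinearMap.sub_apply, LinearMap.smul_apply, Module.End.one_apply, map_sub,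
        LinearMap.map_smulₛₗ, smul_eq_mul, RingHom.id_apply] at h₁ h₂
      exact (mul_eq_zero.1 (show ((starRingEnd ℂ) a + b) * h u v = 0 by
        linear_combination h₃ - h₁ - h₂)).resolve_left hab

/-- If `(X - a) (X - b)` divides the characteristic polynomial, there are linearly independent
vectors in the generalized eigenspaces of `a` and `b`. -/
theorem Module.End.exists_linearIndependent_pair_of_dvd_charpoly {K V : Type*} [Field K]
    [AddCommGroup V] [Module K V] [FiniteDimensional K V] (T : Module.End K V) {a b : K}
    (h : (X - C a) * (X - C b) ∣ T.charpoly) :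
    ∃ u ∈ T.maxGenEigenspace a, ∃ v ∈ T.maxGenEigenspace b, LinearIndependent K ![u, v] := by
  have h0 : T.charpoly ≠ 0 := T.charpoly_monic.ne_zero
  by_cases hab : a = b
  · subst hab
    have h2 : 1 < Module.finrank K (T.maxGenEigenspace a) := by
      rw [LinearMap.finrank_maxGenEigenspace_eq]
      exact (le_rootMultiplicity_iff h0).2 (by rwa [pow_two])
    obtain ⟨u, hu⟩ := Module.finrank_pos_iff_exists_ne_zero.1 (zero_lt_one.trans h2)
    obtain ⟨v, hv⟩ := exists_linearIndependent_pair_of_one_lt_finrank h2 hu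
    refine ⟨u, u.2, v, v.2, ?_⟩
    have := hv.map' (T.maxGenEigenspace a).subtype (Submodule.ker_subtype _)
    rwa [show (T.maxGenEigenspace a).subtype ∘ ![u, v] = ![(u : V), (v : V)] by
      ext i; fin_cases i <;> rfl] at this
  · have ev : ∀ c, X - C c ∣ T.charpoly → T.HasEigenvalue c := fun c hc =>
      (T.hasEigenvalue_iff_isRoot_charpoly c).2 (dvd_iff_isRoot.1 hc)
    obtain ⟨u, hu⟩ := (ev a ((dvd_mul_right _ _).trans h)).exists_hasEigenvector
    obtain ⟨v, hv⟩ := (ev b ((dvd_mul_left _ _).trans h)).exists_hasEigenvector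
    refine ⟨u, (T.genEigenspace_le_maximal a 1) hu.1, v, (T.genEigenspace_le_maximal b 1) hv.1, ?_⟩
    refine Module.End.eigenvectors_linearIndependent' T ![a, b] ?_ ![u, v] ?_
    · intro i j hij
      fin_cases i <;> fin_cases j <;> simp_all [eq_comm]
    · intro i
      fin_cases i <;> assumption

/-- The Minkowski form on `ℂ^{n+2}`, conjugate-linear in the first variable. -/
noncomputable def minkSesq (n : ℕ) :
    (Fin (n + 2) → ℂ) →ₗ⋆[ℂ] (Fin (n + 2) → ℂ) →ₗ[ℂ] ℂ :=
  LinearMap.mk₂'ₛₗ (starRingEnd ℂ) (RingHom.id ℂ)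
    (fun u v => -(star (u 0) * v 0) + ∑ k : Fin (n + 1), star (u k.succ) * v k.succ)
    (fun u u' v => by simp [add_mul, Finset.sum_add_distrib]; ring)
    (fun c u v => by simp [mul_add, Finset.mul_sum, mul_assoc])
    (fun u v v' => by simp [mul_add, Finset.sum_add_distrib]; ring)
    (fun c u v => by simp [mul_add, Finset.mul_sum, mul_left_comm])

theorem minkSesq_apply (n : ℕ) (u v : Fin (n + 2) → ℂ) :
    minkSesq n u v = -(star (u 0) * v 0) + ∑ k : Fin (n + 1), star (u k.succ) * v k.succ := rfl

/-- A vector of vanishing time component is null only if it is zero. -/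
theorem eq_zero_of_minkSesq_self_eq_zero {n : ℕ} {w : Fin (n + 2) → ℂ} (h0 : w 0 = 0)
    (h : minkSesq n w w = 0) : w = 0 := by
  have h' : ∑ k : Fin (n + 1), Complex.normSq (w k.succ) = 0 := by
    rw [minkSesq_apply] at h
    simp only [h0, mul_zero, neg_zero, zero_add, Complex.star_def,
      ← Complex.normSq_eq_conj_mul_self] at h
    exact_mod_cast h
  rw [Finset.sum_eq_zero_iff_of_nonneg fun _ _ => Complex.normSq_nonneg _] at h'
  ext i
  refine Fin.cases h0 (fun k => ?_) i
  simpa using h' k (Finset.mem_univ k)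

/-- There is no totally isotropic plane. -/
theorem not_linearIndependent_of_isotropic {n : ℕ} {u v : Fin (n + 2) → ℂ}
    (huu : minkSesq n u u = 0) (huv : minkSesq n u v = 0) (hvu : minkSesq n v u = 0)
    (hvv : minkSesq n v v = 0) : ¬ LinearIndependent ℂ ![u, v] := by
  intro hli
  rw [LinearIndependent.pair_iff] at hli
  have hw : v 0 • u + (-u 0) • v = 0 := by
    apply eq_zero_of_minkSesq_self_eq_zero
    · simp [mul_comm]
    · simp [LinearMap.map_smulₛₗ, huu, huv, hvu, hvv]
  have hu : u = 0 := eq_zero_of_minkSesq_self_eq_zero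
    (neg_eq_zero.1 (hli _ _ hw).2) huu
  simpa using hli 1 0 (by simp [hu])

/-- The signature of the Minkowski form. -/
def minkSign (n : ℕ) : Fin (n + 2) → ℝ := Fin.cons (-1) 1

theorem mink_eq_sum (n : ℕ) (u v : Fin (n + 2) → ℝ) :
    mink n u v = ∑ i, minkSign n i * (u i * v i) := by
  rw [Fin.sum_univ_succ]
  simp [mink, minkSign]

theorem minkSesq_eq_sum (n : ℕ) (u v : Fin (n + 2) → ℂ) :
    minkSesq n u v = ∑ i, (minkSign n i : ℂ) * (star (u i) * v i) := by
  rw [Fin.sum_univ_succ]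
  simp [minkSesq_apply, minkSign]

section Skew

variable {n : ℕ} {F : Matrix (Fin (n + 2)) (Fin (n + 2)) ℝ}

theorem minkSign_mul_add_eq_zero (hF : ∀ u v, mink n (F.mulVec u) v + mink n u (F.mulVec v) = 0)
    (i j : Fin (n + 2)) : minkSign n j * F j i + minkSign n i * F i j = 0 := by
  simpa [mink_eq_sum, Pi.single_apply] using hF (Pi.single i 1) (Pi.single j 1)

theorem minkSesq_skew (hF : ∀ u v, mink n (F.mulVec u) v + mink n u (F.mulVec v) = 0)
    (u v : Fin (n + 2) → ℂ) :
    minkSesq n ((F.map Complex.ofRealHom).toLin' u) v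
      + minkSesq n u ((F.map Complex.ofRealHom).toLin' v) = 0 := by
  simp only [minkSesq_eq_sum, Matrix.toLin'_apply, Matrix.mulVec, dotProduct, Matrix.map_apply,
    star_sum, star_mul', Finset.sum_mul, Finset.mul_sum]
  rw [Finset.sum_comm, ← Finset.sum_add_distrib]
  refine Finset.sum_eq_zero fun i _ => ?_
  rw [← Finset.sum_add_distrib]
  refine Finset.sum_eq_zero fun j _ => ?_
  have h : (minkSign n j * F j i + minkSign n i * F i j : ℂ) = 0 := by
    exact_mod_cast minkSign_mul_add_eq_zero hF i j
  simp only [Complex.ofRealHom_eq_coe, Complex.star_def, Complex.conj_ofReal]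
  linear_combination (starRingEnd ℂ (u i) * v j) * h

/-- Counted with multiplicity, the characteristic polynomial has at most one root of positive
real part. -/
theorem not_mul_dvd_charpoly (hF : ∀ u v, mink n (F.mulVec u) v + mink n u (F.mulVec v) = 0)
    {a b : ℂ} (ha : 0 < a.re) (hb : 0 < b.re) :
    ¬ (X - C a) * (X - C b) ∣ F.charpoly.map Complex.ofRealHom := by
  rw [← Matrix.charpoly_map, ← Matrix.charpoly_toLin']
  intro h
  obtain ⟨u, hu, v, hv, hli⟩ := Module.End.exists_linearIndependent_pair_of_dvd_charpoly _ h
  have pos : ∀ {c d : ℂ}, 0 < c.re → 0 < d.re → starRingEnd ℂ c + d ≠ 0 := by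
    intro c d hc hd hcd
    have := congrArg Complex.re hcd
    simp at this
    linarith
  have orth {c d : ℂ} (hc : 0 < c.re) (hd : 0 < d.re) {x y} (hx : x ∈ _) (hy : y ∈ _) :=
    Module.End.sesq_eq_zero_of_mem_maxGenEigenspace (minkSesq n) _ (minkSesq_skew hF)
      (pos hc hd) (u := x) (v := y) hx hy
  exact not_linearIndependent_of_isotropic (orth ha ha hu hu) (orth ha hb hu hv)
    (orth hb ha hv hu) (orth hb hb hv hv) hli

theorem charpoly_eval_neg (hF : ∀ u v, mink n (F.mulVec u) v + mink n u (F.mulVec v) = 0)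
    (x : ℝ) : F.charpoly.eval (-x) = (-1) ^ n * F.charpoly.eval x := by
  have hs : ∀ i, minkSign n i * minkSign n i = 1 :=
    Fin.cases (by simp [minkSign]) (by simp [minkSign])
  have hD : Matrix.diagonal (minkSign n) * Matrix.diagonal (minkSign n) = 1 := by
    simp [Matrix.diagonal_mul_diagonal, hs]
  have key : (Matrix.scalar (Fin (n + 2)) (-x) - F) = -(Matrix.diagonal (minkSign n) *
      (Matrix.scalar (Fin (n + 2)) x - F).transpose * Matrix.diagonal (minkSign n)) := by
    ext i j
    have h := minkSign_mul_add_eq_zero hF i j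
    by_cases hij : i = j
    · subst hij
      simp
      linear_combination x * hs i - minkSign n i * h + F i i * hs i
    · simp [hij]
      linear_combination (-minkSign n i) * h + F i j * hs i
  rw [Matrix.eval_charpoly, Matrix.eval_charpoly, key, Matrix.det_neg, Matrix.det_mul,
    Matrix.det_mul, Matrix.det_transpose, Fintype.card_fin]
  have hdet := congrArg Matrix.det hD
  rw [Matrix.det_mul, Matrix.det_one] at hdet
  linear_combination (-1) ^ n * (Matrix.scalar (Fin (n + 2)) x - F).det * hdet

theorem charpoly_neg_sq_eval (hF : ∀ u v, mink n (F.mulVec u) v + mink n u (F.mulVec v) = 0)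
    (x : ℝ) : (-(F * F)).charpoly.eval (-x ^ 2) = (-1) ^ n * F.charpoly.eval x ^ 2 := by
  have key : Matrix.scalar (Fin (n + 2)) (-x ^ 2) - -(F * F)
      = (Matrix.scalar _ x - F) * (Matrix.scalar _ (-x) - F) := by
    have hc : Matrix.scalar (Fin (n + 2)) x * F = F * Matrix.scalar (Fin (n + 2)) x :=
      Algebra.commutes x F
    rw [map_neg, map_neg, map_pow]
    rw [sub_mul, mul_sub, mul_sub, mul_neg, mul_neg, hc, pow_two]
    abel
  rw [Matrix.eval_charpoly, key, Matrix.det_mul, ← Matrix.eval_charpoly, ← Matrix.eval_charpoly,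
    charpoly_eval_neg hF]
  ring

end Skew

theorem Polynomial.expand_two_contract_two {p : ℝ[X]} (h : ∀ x, p.eval (-x) = p.eval x) :
    expand ℝ 2 (contract 2 p) = p := by
  have hp : p.comp (C (-1) * X) = p := Polynomial.funext fun x => by simp [h]
  ext k
  rw [coeff_expand two_pos, coeff_contract two_ne_zero]
  split_ifs with hk
  · rw [Nat.div_mul_cancel hk]
  · have hc := congrArg (coeff · k) hp
    simp only [comp_C_mul_X_coeff, (Nat.not_even_iff_odd.1 (mt Even.two_dvd hk)).neg_one_pow] at hc
    linarith

/-- A monic even polynomial of degree `2 * m` is, up to sign, a monic polynomial in `-X ^ 2`. -/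
theorem Polynomial.Monic.exists_eq_comp_neg_sq {p : ℝ[X]} (hp : p.Monic) {m : ℕ}
    (hm : p.natDegree = m * 2) (h : ∀ x, p.eval (-x) = p.eval x) :
    ∃ Q : ℝ[X], Q.Monic ∧ Q.natDegree = m ∧ ∀ x, p.eval x = (-1) ^ m * Q.eval (-x ^ 2) := by
  obtain ⟨R, rfl⟩ : ∃ R, Polynomial.expand ℝ 2 R = p := ⟨_, expand_two_contract_two h⟩
  have hR : R.Monic := (monic_expand_iff two_pos).1 hp
  have hd : R.natDegree = m := by
    rw [natDegree_expand] at hm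
    omega
  refine ⟨_, hR.neg_one_pow_natDegree_mul_comp_neg_X, ?_, fun x => ?_⟩
  · rcases neg_one_pow_eq_or ℝ[X] R.natDegree with hsgn | hsgn <;>
      rw [hsgn] <;> simp [natDegree_comp, hd]
  · simp [expand_eval, hd, ← mul_assoc, ← mul_pow]

/-- A monic polynomial whose parity is that of its degree `d` is, up to sign, a power of `X` times
a monic polynomial in `-X ^ 2`. -/
theorem Polynomial.Monic.exists_comp_neg_sq {n : ℕ} {p : ℝ[X]} (hp : p.Monic)
    (hn : p.natDegree = n + 2) (h : ∀ x, p.eval (-x) = (-1) ^ n * p.eval x) :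
    ∃ Q : ℝ[X], Q.Monic ∧ Q.natDegree = n / 2 + 1 ∧ Q.comp (-X ^ 2) ∣ p ∧
      (Even n → ∀ x, p.eval x ^ 2 = Q.eval (-x ^ 2) ^ 2) ∧
      (Odd n → ∀ x, p.eval x ^ 2 = x ^ 2 * Q.eval (-x ^ 2) ^ 2) := by
  rcases Nat.even_or_odd n with hpar | hpar
  · obtain ⟨Q, hQ, hd, he⟩ := hp.exists_eq_comp_neg_sq (m := n / 2 + 1)
      (by have := hpar.two_dvd; omega) (by simpa [hpar.neg_one_pow] using h)
    refine ⟨Q, hQ, hd, ⟨C ((-1) ^ (n / 2 + 1)), Polynomial.funext fun x => ?_⟩, fun _ x => ?_,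
      fun ho => absurd hpar (Nat.not_even_iff_odd.2 ho)⟩
    · simp [he, mul_comm]
    · simp [he, mul_pow, ← pow_mul, mul_comm _ 2]
  · have h0 : p.IsRoot 0 := by
      have := h 0
      rw [hpar.neg_one_pow, neg_zero] at this
      rw [IsRoot]
      linarith
    obtain ⟨s, rfl⟩ : X ∣ p := by simpa using dvd_iff_isRoot.2 h0
    have hs : s.Monic := monic_X.of_mul_monic_left hp
    have hsd : s.natDegree = (n / 2 + 1) * 2 := by
      rw [natDegree_X_mul hs.ne_zero] at hn
      obtain ⟨k, rfl⟩ := hpar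
      omega
    have hse : s.comp (-X) = s := by
      refine mul_left_cancel₀ (X_ne_zero (R := ℝ)) (Polynomial.funext fun x => ?_)
      have := h x
      simp only [eval_mul, eval_X, hpar.neg_one_pow] at this
      simp only [eval_mul, eval_X, eval_comp, eval_neg]
      linarith
    obtain ⟨Q, hQ, hd, he⟩ := hs.exists_eq_comp_neg_sq hsd
      fun x => by simpa using congrArg (eval x) hse
    refine ⟨Q, hQ, hd, ⟨X * C ((-1) ^ (n / 2 + 1)), Polynomial.funext fun x => ?_⟩,
      fun ho => absurd ho (Nat.not_even_iff_odd.2 hpar), fun _ x => ?_⟩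
    · simp [he]; ring
    · simp [he, mul_pow, ← pow_mul, mul_comm _ 2]

/-- If `p` has at most one complex root of positive real part, every polynomial in `-X ^ 2`
dividing `p` comes from a polynomial which splits over `ℝ`. -/
theorem Polynomial.splits_of_comp_neg_sq_dvd {p Q : ℝ[X]} (hpQ : Q.comp (-X ^ 2) ∣ p)
    (hp : ∀ a b : ℂ, 0 < a.re → 0 < b.re → ¬ (X - C a) * (X - C b) ∣ p.map Complex.ofRealHom) :
    Q.Splits := by
  refine Splits.of_splits_map Complex.ofRealHom (IsAlgClosed.splits _) fun y hy => ?_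
  suffices hy' : y.im = 0 from ⟨y.re, Complex.ext rfl hy'.symm⟩
  obtain ⟨z, hz⟩ := IsAlgClosed.exists_pow_nat_eq (-y) two_pos
  have hroot : ∀ w : ℂ, w ^ 2 = -y → aeval w p = 0 := by
    intro w hw
    refine eq_zero_of_zero_dvd ?_
    have := _root_.map_dvd (aeval w) hpQ
    rw [aeval_comp] at this
    have hy0 : aeval y Q = 0 := by
      have := (mem_roots'.1 hy).2
      rwa [IsRoot, eval_map] at this
    simpa [hw, hy0] using this
  have hpos : ∀ w : ℂ, w ^ 2 = -y → 0 < w.re → y.im = 0 := by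
    intro w hw hre
    by_cases hc : w = starRingEnd ℂ w
    · have := congrArg Complex.im hw
      simp [pow_two, Complex.conj_eq_iff_im.1 hc.symm] at this
      exact this
    · refine absurd (IsCoprime.mul_dvd (isCoprime_X_sub_C_of_isUnit_sub
        (sub_ne_zero.2 hc).isUnit) ?_ ?_) (hp w (starRingEnd ℂ w) hre (by simpa))
      · rw [dvd_iff_isRoot, IsRoot, eval_map]
        exact hroot w hw
      · rw [dvd_iff_isRoot, IsRoot, eval_map]
        have := aeval_conj p w
        rwa [hroot w hw, map_zero] at this
  rcases lt_trichotomy z.re 0 with h | h | h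
  · exact hpos (-z) (by rw [neg_sq, hz]) (by simpa)
  · have := congrArg Complex.im hz
    simp [pow_two, h] at this
    exact this
  · exact hpos z hz h

theorem Polynomial.card_neg_roots_le_one_of_comp_neg_sq_dvd {p Q : ℝ[X]} (hpQ : Q.comp (-X ^ 2) ∣ p)
    (hp : ∀ a b : ℂ, 0 < a.re → 0 < b.re → ¬ (X - C a) * (X - C b) ∣ p.map Complex.ofRealHom) :
    Multiset.card (Q.roots.filter fun x => x < 0) ≤ 1 := by
  by_contra! hcard
  obtain ⟨y, hy⟩ := Multiset.card_pos_iff_exists_mem.1 (zero_lt_one.trans hcard)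
  obtain ⟨t, ht⟩ := Multiset.exists_cons_of_mem hy
  rw [ht, Multiset.card_cons] at hcard
  obtain ⟨z, hz⟩ := Multiset.card_pos_iff_exists_mem.1 (Nat.lt_of_succ_lt_succ hcard)
  obtain ⟨t, rfl⟩ := Multiset.exists_cons_of_mem hz
  have hy0 : y < 0 := (Multiset.mem_filter.1 hy).2
  have hz0 : z < 0 := by
    have : z ∈ Q.roots.filter (fun x => x < 0) := by simp [ht]
    exact (Multiset.mem_filter.1 this).2
  have hle : ({y, z} : Multiset ℝ) ≤ Q.roots := by
    refine le_trans ?_ (Multiset.filter_le (fun x => x < 0) _)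
    rw [ht]
    exact Multiset.cons_le_cons _ (Multiset.cons_le_cons _ (Multiset.zero_le _))
  have hdvd : (X - C y) * (X - C z) ∣ Q := by
    simpa using (Multiset.prod_dvd_prod_of_le (Multiset.map_le_map hle)).trans
      Q.prod_multiset_X_sub_C_dvd
  have hfac : ∀ {c : ℝ}, c < 0 → X - C √(-c) ∣ (X - C c).comp (-X ^ 2) := by
    intro c hc
    rw [dvd_iff_isRoot]
    simp [Real.sq_sqrt (neg_nonneg.2 hc.le)]
  have hcomp : (X - C √(-y)) * (X - C √(-z)) ∣ p := by
    obtain ⟨r, hr⟩ := hdvd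
    refine ((mul_dvd_mul (hfac hy0) (hfac hz0)).trans ?_).trans hpQ
    rw [hr, mul_comp, mul_comp]
    exact dvd_mul_right _ _
  refine hp (√(-y) : ℝ) (√(-z) : ℝ) (by simpa) (by simpa) ?_
  simpa using Polynomial.map_dvd Complex.ofRealHom hcomp

/-- for an `η`-skew-symmetric endomorphism `F` of `ℝ^{n+2}` and `q = ⌊n/2⌋`,
there is a monic real polynomial `Q` of degree `q+1`, splitting over `ℝ`, with
`charpoly(−F²) = Q²` (`n` even) or `X·Q²` (`n` odd), and at most one root of `Q`
(with multiplicity) is negative. -/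
theorem stmt2 (n : ℕ) (hn : 1 ≤ n) (q : ℕ) (hq : q = n / 2)
    (F : Matrix (Fin (n + 2)) (Fin (n + 2)) ℝ)
    (hF : ∀ u v, mink n (F.mulVec u) v + mink n u (F.mulVec v) = 0) :
    ∃ Q : Polynomial ℝ, Q.Monic ∧ Q.natDegree = q + 1 ∧
      Multiset.card Q.roots = q + 1 ∧
      (Even n → (-(F * F)).charpoly = Q ^ 2) ∧
      (Odd n → (-(F * F)).charpoly = Polynomial.X * Q ^ 2) ∧
      Multiset.card (Q.roots.filter fun x => x < 0) ≤ 1 := by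
  subst hq
  obtain ⟨Q, hQ, hd, hdvd, heven, hodd⟩ := F.charpoly_monic.exists_comp_neg_sq
    (by simp [Matrix.charpoly_natDegree_eq_dim]) (charpoly_eval_neg hF)
  have hp : ∀ a b : ℂ, 0 < a.re → 0 < b.re →
      ¬ (X - C a) * (X - C b) ∣ F.charpoly.map Complex.ofRealHom :=
    fun _ _ ha hb => not_mul_dvd_charpoly hF ha hb
  have ext_neg : ∀ {A B : ℝ[X]}, (∀ x, A.eval (-x ^ 2) = B.eval (-x ^ 2)) → A = B := by
    intro A B h
    refine eq_of_infinite_eval_eq A B ((Set.Iic_infinite (0 : ℝ)).mono fun y hy => ?_)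
    simpa [Real.sq_sqrt (neg_nonneg.2 (Set.mem_Iic.1 hy))] using h √(-y)
  refine ⟨Q, hQ, hd, ?_, fun h => ext_neg fun x => ?_, fun h => ext_neg fun x => ?_,
    card_neg_roots_le_one_of_comp_neg_sq_dvd hdvd hp⟩
  · rw [splits_iff_card_roots.1 (splits_of_comp_neg_sq_dvd hdvd hp), hd]
  · simp [charpoly_neg_sq_eval hF, heven h, h.neg_one_pow]
  · simp [charpoly_neg_sq_eval hF, hodd h, h.neg_one_pow]
end

section
/- Let n ≥ 1 and let F, F' be η-skew-symmetric endomorphisms of ℝ^{n+2}. Call Λ an orthochronous Lorentz transformation if Λ is a linear automorphism of ℝ^{n+2} with η(Λu,Λv) = η(u,v) for all u,v and η(Λe₀, e₀) < 0. Then there exists an orthochronous Lorentz transformation Λ with F' = Λ∘F∘Λ⁻¹ if and only if F² and F'² have the same characteristic polynomial and, in addition: for n odd, ker F contains a timelike vector exactly when ker F' does; for n even, the restriction of η to ker F is degenerate exactly when the restriction of η to ker F' is degenerate. -/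
open Matrix

/-- `B` is symmetric and `F` is skew-adjoint with respect to `B`. -/
structure SkewPair {V : Type*} [AddCommGroup V] [Module ℝ V]
    (B : LinearMap.BilinForm ℝ V) (F : V →ₗ[ℝ] V) : Prop where
  symm : ∀ x y, B x y = B y x
  skew : ∀ x y, B (F x) y = -B x (F y)

/-- Negative semidefinite subspaces have dimension at most one. -/
def AtMostOneNeg {V : Type*} [AddCommGroup V] [Module ℝ V]
    (B : LinearMap.BilinForm ℝ V) : Prop :=
  ∀ x y, x ≠ 0 → B x x ≤ 0 → B y y ≤ 0 → B x y = 0 → ∃ c : ℝ, y = c • x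

/-- There is a linear isometry intertwining `F` and `F'`. -/
def SkewIso {V V' : Type*} [AddCommGroup V] [Module ℝ V] [AddCommGroup V'] [Module ℝ V']
    (B : LinearMap.BilinForm ℝ V) (F : V →ₗ[ℝ] V)
    (B' : LinearMap.BilinForm ℝ V') (F' : V' →ₗ[ℝ] V') : Prop :=
  ∃ e : V ≃ₗ[ℝ] V', (∀ x y, B' (e x) (e y) = B x y) ∧ ∀ x, e (F x) = F' (e x)

/-- The vectors `b i` have Gram matrix `G`, and `F` acts on them through the matrix `M`. -/
structure IsBlock {V ι : Type*} [AddCommGroup V] [Module ℝ V] [Fintype ι]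
    (B : LinearMap.BilinForm ℝ V) (F : V →ₗ[ℝ] V) (G M : Matrix ι ι ℝ) (b : ι → V) : Prop where
  gram : ∀ i j, B (b i) (b j) = G i j
  map : ∀ i, F (b i) = ∑ j, M i j • b j

section Splitting

variable {V V' ι : Type*} [AddCommGroup V] [Module ℝ V]
  [AddCommGroup V'] [Module ℝ V'] [Fintype ι]
  {B : LinearMap.BilinForm ℝ V} {F : V →ₗ[ℝ] V}
  {B' : LinearMap.BilinForm ℝ V'} {F' : V' →ₗ[ℝ] V'}
  {G M : Matrix ι ι ℝ} {b : ι → V} {b' : ι → V'}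

lemma SkewPair.isRefl (h : SkewPair B F) : B.IsRefl := fun x y hxy => by
  rw [h.symm, hxy]

lemma SkewPair.self_map (h : SkewPair B F) (x : V) : B x (F x) = 0 := by
  have := h.skew x x
  have := h.symm x (F x)
  linarith

lemma SkewPair.restrict (h : SkewPair B F) {W : Submodule ℝ V} (hW : ∀ x ∈ W, F x ∈ W) :
    SkewPair (B.restrict W) (F.restrict hW) :=
  ⟨fun x y => h.symm x y, fun x y => h.skew x y⟩

lemma SkewPair.map_mem_orthogonal (h : SkewPair B F) {W : Submodule ℝ V}
    (hW : ∀ x ∈ W, F x ∈ W) : ∀ x ∈ B.orthogonal W, F x ∈ B.orthogonal W := by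
  intro x hx y hy
  have := hx (F y) (hW y hy)
  have h2 := h.skew y x
  change B (F y) x = 0 at this
  change B y (F x) = 0
  linarith

lemma AtMostOneNeg.restrict (h : AtMostOneNeg B) (W : Submodule ℝ V) :
    AtMostOneNeg (B.restrict W) := by
  intro x y hx hxx hyy hxy
  obtain ⟨c, hc⟩ := h x y (by simpa using hx) hxx hyy hxy
  exact ⟨c, Subtype.ext hc⟩

lemma SkewIso.of_isCompl
    {W P : Submodule ℝ V} {W' P' : Submodule ℝ V'}
    (hB : ∀ x ∈ W, ∀ y ∈ P, B x y = 0 ∧ B y x = 0)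
    (hB' : ∀ x ∈ W', ∀ y ∈ P', B' x y = 0 ∧ B' y x = 0)
    (hW : ∀ x ∈ W, F x ∈ W) (hP : ∀ x ∈ P, F x ∈ P)
    (hW' : ∀ x ∈ W', F' x ∈ W') (hP' : ∀ x ∈ P', F' x ∈ P')
    (hc : IsCompl W P) (hc' : IsCompl W' P')
    (e₁ : SkewIso (B.restrict W) (F.restrict hW) (B'.restrict W') (F'.restrict hW'))
    (e₂ : SkewIso (B.restrict P) (F.restrict hP) (B'.restrict P') (F'.restrict hP')) :
    SkewIso B F B' F' := by
  obtain ⟨e₁, h₁, k₁⟩ := e₁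
  obtain ⟨e₂, h₂, k₂⟩ := e₂
  let p := Submodule.prodEquivOfIsCompl W P hc
  let p' := Submodule.prodEquivOfIsCompl W' P' hc'
  have key : ∀ z, (p.symm ≪≫ₗ (e₁.prodCongr e₂) ≪≫ₗ p') (p z) = (e₁ z.1 : V') + (e₂ z.2 : V') := by
    intro z
    simp [p']
  have hp : ∀ z, p z = (z.1 : V) + z.2 := fun z => by simp [p]
  refine ⟨p.symm ≪≫ₗ (e₁.prodCongr e₂) ≪≫ₗ p', ?_, ?_⟩
  · intro x y
    obtain ⟨x, rfl⟩ := p.surjective x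
    obtain ⟨y, rfl⟩ := p.surjective y
    rw [key, key, hp, hp]
    have a₁ : B' (e₁ x.1) (e₁ y.1) = B x.1 y.1 := h₁ _ _
    have a₂ : B' (e₂ x.2) (e₂ y.2) = B x.2 y.2 := h₂ _ _
    simp only [map_add, LinearMap.add_apply, a₁, a₂,
      (hB _ x.1.2 _ y.2.2).1, (hB _ y.1.2 _ x.2.2).2,
      (hB' _ (e₁ x.1).2 _ (e₂ y.2).2).1, (hB' _ (e₁ y.1).2 _ (e₂ x.2).2).2]
  · intro x
    obtain ⟨x, rfl⟩ := p.surjective x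
    have hx : F (p x) = p (F.restrict hW x.1, F.restrict hP x.2) := by
      simp [hp]
    have a₁ : (e₁ (F.restrict hW x.1) : V') = F' (e₁ x.1) := congrArg Subtype.val (k₁ x.1)
    have a₂ : (e₂ (F.restrict hP x.2) : V') = F' (e₂ x.2) := congrArg Subtype.val (k₂ x.2)
    rw [hx, key, key, a₁, a₂, map_add]

lemma IsBlock.map_mem_span (hb : IsBlock B F G M b) :
    ∀ x ∈ Submodule.span ℝ (Set.range b), F x ∈ Submodule.span ℝ (Set.range b) := by
  intro x hx
  have : Submodule.span ℝ (Set.range b) ≤ (Submodule.span ℝ (Set.range b)).comap F := by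
    rw [Submodule.span_le]
    rintro _ ⟨i, rfl⟩
    simp only [Submodule.comap_coe, Set.mem_preimage, SetLike.mem_coe, hb.map]
    exact Submodule.sum_mem _ fun j _ => Submodule.smul_mem _ _ (Submodule.subset_span ⟨j, rfl⟩)
  exact this hx

lemma mem_orthogonal_span_range {x : V} :
    x ∈ B.orthogonal (Submodule.span ℝ (Set.range b)) ↔ ∀ i, B (b i) x = 0 := by
  constructor
  · intro hx i
    exact hx (b i) (Submodule.subset_span ⟨i, rfl⟩)
  · intro hx y hy
    obtain ⟨c, rfl⟩ := (Submodule.mem_span_range_iff_exists_fun ℝ).1 hy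
    simp [hx]

variable [DecidableEq ι]

lemma IsBlock.linearIndependent (hb : IsBlock B F G M b) (hG : G.det ≠ 0) :
    LinearIndependent ℝ b := by
  rw [Fintype.linearIndependent_iff]
  intro c hc
  have : c ᵥ* G = 0 := by
    ext j
    have := congrArg (fun v => B v (b j)) hc
    simpa [Matrix.vecMul, dotProduct, hb.gram] using this
  exact congrFun (Matrix.eq_zero_of_vecMul_eq_zero hG this)

lemma IsBlock.skewIso_span (hb : IsBlock B F G M b) (hb' : IsBlock B' F' G M b')
    (hG : G.det ≠ 0) :
    SkewIso (B.restrict _) (F.restrict hb.map_mem_span)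
      (B'.restrict _) (F'.restrict hb'.map_mem_span) := by
  let β := Module.Basis.span (hb.linearIndependent hG)
  let β' := Module.Basis.span (hb'.linearIndependent hG)
  have hβ : ∀ i, (β i : V) = b i := fun i =>
    congrArg Subtype.val (Module.Basis.span_apply _ i)
  have hβ' : ∀ i, (β' i : V') = b' i := fun i =>
    congrArg Subtype.val (Module.Basis.span_apply _ i)
  let e := β.equiv β' (Equiv.refl ι)
  have he : ∀ i, e (β i) = β' i := fun i => by simp [e]
  refine ⟨e, ?_, ?_⟩
  · have : (B'.restrict _).compl₁₂ e.toLinearMap e.toLinearMap = B.restrict _ := by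
      refine β.ext fun i => β.ext fun j => ?_
      simp [he, hβ, hβ', hb.gram, hb'.gram]
    intro x y
    exact LinearMap.congr_fun (LinearMap.congr_fun this x) y
  · have : e.toLinearMap ∘ₗ F.restrict hb.map_mem_span =
        F'.restrict hb'.map_mem_span ∘ₗ e.toLinearMap := by
      refine β.ext fun i => ?_
      have h₁ : F.restrict hb.map_mem_span (β i) = ∑ j, M i j • β j := by
        ext; simp [hβ, hb.map]
      have h₂ : F'.restrict hb'.map_mem_span (β' i) = ∑ j, M i j • β' j := by
        ext; simp [hβ', hb'.map]
      simp only [LinearMap.comp_apply, LinearEquiv.coe_coe, he, h₁, h₂, map_sum, map_smul]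
    intro x
    exact LinearMap.congr_fun this x

variable [FiniteDimensional ℝ V] [FiniteDimensional ℝ V']

lemma SkewIso.charpoly_eq (h : SkewIso B F B' F') :
    (F ∘ₗ F).charpoly = (F' ∘ₗ F').charpoly := by
  obtain ⟨e, -, he⟩ := h
  rw [← e.charpoly_conj (F ∘ₗ F)]
  congr 1
  ext x
  simp [LinearEquiv.conj_apply, he]

lemma charpoly_eq_of_isCompl {W P : Submodule ℝ V} (hW : ∀ x ∈ W, F x ∈ W)
    (hP : ∀ x ∈ P, F x ∈ P) (hc : IsCompl W P) :
    (F ∘ₗ F).charpoly = (F.restrict hW ∘ₗ F.restrict hW).charpoly *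
      (F.restrict hP ∘ₗ F.restrict hP).charpoly := by
  let p := Submodule.prodEquivOfIsCompl W P hc
  rw [← LinearMap.charpoly_prodMap, ← p.charpoly_conj]
  congr 1
  ext x
  obtain ⟨x, rfl⟩ := p.surjective x
  simp [p, LinearEquiv.conj_apply]

lemma IsBlock.isCompl (h : SkewPair B F) (hb : IsBlock B F G M b) (hG : G.det ≠ 0) :
    IsCompl (Submodule.span ℝ (Set.range b)) (B.orthogonal (Submodule.span ℝ (Set.range b))) := by
  rw [LinearMap.BilinForm.isCompl_orthogonal_iff_disjoint h.isRefl, Submodule.disjoint_def]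
  intro x hx hx'
  obtain ⟨c, rfl⟩ := (Submodule.mem_span_range_iff_exists_fun ℝ).1 hx
  have : G *ᵥ c = 0 := by
    ext j
    have : B (b j) (∑ i, c i • b i) = 0 := hx' (b j) (Submodule.subset_span ⟨j, rfl⟩)
    simpa [Matrix.mulVec, dotProduct, hb.gram, mul_comm] using this
  simp [Matrix.eq_zero_of_mulVec_eq_zero hG this]

/-- Splitting off blocks with the same Gram matrix and the same action reduces the
classification of skew pairs to the orthogonal complements of the blocks. -/
theorem SkewIso.of_isBlock (h : SkewPair B F) (h' : SkewPair B' F') (hG : G.det ≠ 0)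
    (hb : IsBlock B F G M b) (hb' : IsBlock B' F' G M b')
    (hχ : (F ∘ₗ F).charpoly = (F' ∘ₗ F').charpoly)
    (ih : ∀ (P : Submodule ℝ V) (P' : Submodule ℝ V')
      (hP : ∀ x ∈ P, F x ∈ P) (hP' : ∀ x ∈ P', F' x ∈ P'),
      Module.finrank ℝ P + Fintype.card ι = Module.finrank ℝ V →
      (∀ x ∈ P, ∀ i, B (b i) x = 0) → (∀ x ∈ P', ∀ i, B' (b' i) x = 0) →
      (F.restrict hP ∘ₗ F.restrict hP).charpoly = (F'.restrict hP' ∘ₗ F'.restrict hP').charpoly →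
      SkewIso (B.restrict P) (F.restrict hP) (B'.restrict P') (F'.restrict hP')) :
    SkewIso B F B' F' := by
  have e₁ := hb.skewIso_span hb' hG
  have hc := hb.isCompl h hG
  have hc' := hb'.isCompl h' hG
  have hP := h.map_mem_orthogonal hb.map_mem_span
  have hP' := h'.map_mem_orthogonal hb'.map_mem_span
  refine SkewIso.of_isCompl (fun x hx y (hy : y ∈ B.orthogonal _) =>
    ⟨hy x hx, (h.symm y x).trans (hy x hx)⟩)
    (fun x hx y (hy : y ∈ B'.orthogonal _) =>
    ⟨hy x hx, (h'.symm y x).trans (hy x hx)⟩) hb.map_mem_span hP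
    hb'.map_mem_span hP' hc hc' e₁ (ih _ _ hP hP' ?_ ?_ ?_ ?_)
  · rw [← Submodule.finrank_add_eq_of_isCompl hc, finrank_span_eq_card (hb.linearIndependent hG),
      add_comm]
  · exact fun x hx => mem_orthogonal_span_range.1 hx
  · exact fun x hx => mem_orthogonal_span_range.1 hx
  · rw [charpoly_eq_of_isCompl hb.map_mem_span hP hc,
      charpoly_eq_of_isCompl hb'.map_mem_span hP' hc', e₁.charpoly_eq] at hχ
    exact mul_left_cancel₀ (LinearMap.charpoly_monic _).ne_zero hχ

end Splitting

section Existence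

variable {V : Type*} [AddCommGroup V] [Module ℝ V]
  {B : LinearMap.BilinForm ℝ V} {F : V →ₗ[ℝ] V}

lemma exists_eigenvector_or_quadratic [FiniteDimensional ℝ V] [Nontrivial V] (F : V →ₗ[ℝ] V) :
    ∃ v ≠ 0, (∃ σ : ℝ, F v = σ • v) ∨
      ∃ a b : ℝ, a ^ 2 + 4 * b < 0 ∧ F (F v) = a • F v + b • v := by
  have hm : IsIntegral ℝ F := Algebra.IsIntegral.isIntegral F
  obtain ⟨q, hq, r, hr⟩ := Polynomial.exists_irreducible_of_natDegree_pos
    (minpoly.natDegree_pos hm)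
  have hr0 : r ≠ 0 := by
    rintro rfl
    exact minpoly.ne_zero hm (by simpa using hr)
  have hrF : Polynomial.aeval F r ≠ 0 := by
    intro h0
    have h₁ := Polynomial.degree_le_of_dvd (minpoly.dvd ℝ F h0) hr0
    have h₂ := congrArg Polynomial.natDegree hr
    rw [Polynomial.natDegree_mul hq.ne_zero hr0] at h₂
    have h₃ := Polynomial.natDegree_le_natDegree h₁
    have := hq.natDegree_pos
    omega
  obtain ⟨x, hx⟩ : ∃ x, Polynomial.aeval F r x ≠ 0 := by
    by_contra! h
    exact hrF (LinearMap.ext h)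
  set v := Polynomial.aeval F r x with hv
  have hqv : Polynomial.aeval F q v = 0 := by
    rw [hv, ← Module.End.mul_apply, ← map_mul, ← hr, minpoly.aeval, LinearMap.zero_apply]
  have hdeg := hq.degree_pos
  rw [Polynomial.eq_quadratic_of_degree_le_two hq.degree_le_two] at hqv hdeg
  set c₀ := q.coeff 0
  set c₁ := q.coeff 1
  set c₂ := q.coeff 2
  have hqv' : c₂ • F (F v) + c₁ • F v + c₀ • v = 0 := by
    simpa [Algebra.algebraMap_eq_smul_one, pow_two] using hqv
  by_cases h₂ : c₂ = 0
  · by_cases h₁ : c₁ = 0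
    · rw [h₂, h₁] at hdeg
      simp at hdeg
      exact absurd hdeg (not_lt.2 Polynomial.degree_C_le)
    · refine ⟨v, hx, Or.inl ⟨-(c₀ / c₁), ?_⟩⟩
      rw [h₂, zero_smul, zero_add] at hqv'
      have : F v = c₁⁻¹ • (c₁ • F v + c₀ • v) - (c₀ / c₁) • v := by
        match_scalars <;> field_simp; ring
      rw [this, hqv']
      module
  · obtain ⟨a, ha⟩ : ∃ a, a = -(c₁ / c₂) := ⟨_, rfl⟩
    obtain ⟨b, hb⟩ : ∃ b, b = -(c₀ / c₂) := ⟨_, rfl⟩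
    have hab : F (F v) = a • F v + b • v := by
      have : F (F v) = c₂⁻¹ • (c₂ • F (F v) + c₁ • F v + c₀ • v) + a • F v + b • v := by
        rw [ha, hb]
        match_scalars <;> field_simp <;> ring
      rw [this, hqv']
      module
    rcases lt_or_ge (a ^ 2 + 4 * b) 0 with hlt | hge
    · exact ⟨v, hx, Or.inr ⟨a, b, hlt, hab⟩⟩
    · have hs := Real.sq_sqrt hge
      set s := √(a ^ 2 + 4 * b)
      by_cases hw : F v - ((a - s) / 2) • v = 0
      · exact ⟨v, hx, Or.inl ⟨(a - s) / 2, sub_eq_zero.1 hw⟩⟩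
      · refine ⟨_, hw, Or.inl ⟨(a + s) / 2, ?_⟩⟩
        have hb' : b = (s ^ 2 - a ^ 2) / 4 := by linarith
        rw [map_sub, map_smul, hab, hb']
        module

lemma SkewPair.exists_eigenvector_or_rotation [FiniteDimensional ℝ V] [Nontrivial V]
    (h : SkewPair B F) (hB : AtMostOneNeg B) :
    ∃ v ≠ 0, (∃ σ : ℝ, F v = σ • v) ∨
      ∃ θ : ℝ, θ ≠ 0 ∧ F (F v) = -(θ ^ 2) • v ∧ 0 < B v v := by
  obtain ⟨v, hv, hσ | ⟨a, b, hab, hF⟩⟩ := exists_eigenvector_or_quadratic F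
  · exact ⟨v, hv, Or.inl hσ⟩
  refine ⟨v, hv, ?_⟩
  have e₀ := h.self_map v
  have e₁ : a * B (F v) (F v) = 0 := by
    have := h.self_map (F v)
    simpa [hF, h.symm (F v) v, e₀] using this
  have e₂ : B (F v) (F v) = -(b * B v v) := by
    rw [h.skew, hF]
    simp [e₀]
  by_cases ha : a = 0
  · subst ha
    have hb : b < 0 := by linarith
    rcases le_or_gt (B v v) 0 with hneg | hpos
    · refine Or.inl (hB v (F v) hv hneg ?_ e₀)
      nlinarith
    · refine Or.inr ⟨√(-b), (Real.sqrt_pos.2 (by linarith)).ne', ?_, hpos⟩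
      rw [hF, Real.sq_sqrt (by linarith)]
      module
  · have e₃ : B (F v) (F v) = 0 := by simpa [ha] using e₁
    have hb : b < 0 := by nlinarith
    have e₄ : B v v = 0 := by
      rw [e₃] at e₂
      have : b * B v v = 0 := by linarith
      simpa [hb.ne] using this
    exact Or.inl (hB v (F v) hv e₄.le e₃.le e₀)

lemma inv_sqrt_mul_inv_sqrt_mul {t : ℝ} (ht : 0 < t) : (√t)⁻¹ * ((√t)⁻¹ * t) = 1 := by
  have := Real.sq_sqrt ht.le
  have := (Real.sqrt_pos.2 ht).ne'
  field_simp
  linarith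

lemma isBlock_of_mem_ker {v : V} {s : ℝ} {G : Matrix (Fin 1) (Fin 1) ℝ} (hv : F v = 0)
    (hG : s * (s * B v v) = G 0 0) : IsBlock B F G 0 ![s • v] := by
  refine ⟨fun i j => ?_, fun i => ?_⟩
  · fin_cases i; fin_cases j
    simp [← hG]
  · fin_cases i
    simp [hv]

lemma SkewPair.isBlock_rotation (h : SkewPair B F) {v : V} {θ : ℝ} (hθ : θ ≠ 0)
    (hv : F (F v) = -(θ ^ 2) • v) (hpos : 0 < B v v) :
    IsBlock B F 1 !![0, θ; -θ, 0] ![(√(B v v))⁻¹ • v, ((√(B v v))⁻¹ / θ) • F v] := by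
  have e₀ := h.self_map v
  have e₁ : B (F v) (F v) = θ ^ 2 * B v v := by
    rw [h.skew, hv]
    simp
  have e₂ : B (F v) v = 0 := by rw [h.symm, e₀]
  have hs := Real.sq_sqrt hpos.le
  have hs0 := (Real.sqrt_pos.2 hpos).ne'
  set s := √(B v v)
  refine ⟨fun i j => ?_, fun i => ?_⟩
  · fin_cases i <;> fin_cases j <;> simp [e₀, e₁, e₂, ← hs] <;> field_simp
  · fin_cases i
    · simp [smul_smul]
      congr 1
      field_simp
    · simp [smul_smul, hv]
      congr 1
      field_simp

end Existence

section Riemannian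

universe u v

lemma AtMostOneNeg.of_pos {V : Type*} [AddCommGroup V] [Module ℝ V]
    {B : LinearMap.BilinForm ℝ V} (hB : ∀ x ≠ 0, 0 < B x x) : AtMostOneNeg B :=
  fun x _ hx hxx => absurd (hB x hx) (not_lt.2 hxx)

lemma exists_sq_eigenvector {V V' : Type*} [AddCommGroup V] [Module ℝ V] [FiniteDimensional ℝ V]
    [AddCommGroup V'] [Module ℝ V'] [FiniteDimensional ℝ V']
    {F : V →ₗ[ℝ] V} {F' : V' →ₗ[ℝ] V'} (hχ : (F ∘ₗ F).charpoly = (F' ∘ₗ F').charpoly)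
    {v : V} {μ : ℝ} (hv : v ≠ 0) (hμ : F (F v) = μ • v) :
    ∃ v' ≠ 0, F' (F' v') = μ • v' := by
  have h₁ : Module.End.HasEigenvalue (F ∘ₗ F) μ :=
    Module.End.hasEigenvalue_of_hasEigenvector (Module.End.hasEigenvector_iff.2
      ⟨Module.End.mem_eigenspace_iff.2 hμ, hv⟩)
  rw [Module.End.hasEigenvalue_iff_isRoot_charpoly, hχ,
    ← Module.End.hasEigenvalue_iff_isRoot_charpoly] at h₁
  obtain ⟨v', hv'⟩ := h₁.exists_hasEigenvector
  exact ⟨v', hv'.2, hv'.apply_eq_smul⟩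

/-- Skew endomorphisms of Euclidean spaces are classified by the characteristic polynomial of
their squares. -/
theorem SkewIso.of_pos (n : ℕ) : ∀ {V : Type u} {V' : Type v}
    [AddCommGroup V] [Module ℝ V] [FiniteDimensional ℝ V]
    [AddCommGroup V'] [Module ℝ V'] [FiniteDimensional ℝ V']
    {B : LinearMap.BilinForm ℝ V} {F : V →ₗ[ℝ] V}
    {B' : LinearMap.BilinForm ℝ V'} {F' : V' →ₗ[ℝ] V'},
    Module.finrank ℝ V = n → SkewPair B F → SkewPair B' F' →
    (∀ x ≠ 0, 0 < B x x) → (∀ x ≠ 0, 0 < B' x x) →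
    (F ∘ₗ F).charpoly = (F' ∘ₗ F').charpoly → SkewIso B F B' F' := by
  induction n using Nat.strong_induction_on with
  | _ n ih =>
  intro V V' _ _ _ _ _ _ B F B' F' hn h h' hB hB' hχ
  rcases subsingleton_or_nontrivial V with hV | hV
  · have hd := congrArg Polynomial.natDegree hχ
    rw [LinearMap.charpoly_natDegree, LinearMap.charpoly_natDegree] at hd
    refine ⟨LinearEquiv.ofFinrankEq V V' hd, fun x y => ?_, fun x => ?_⟩
    · simp [Subsingleton.elim x 0]
    · simp [Subsingleton.elim x 0]
  have step : ∀ (k : ℕ) (G M : Matrix (Fin (k + 1)) (Fin (k + 1)) ℝ) (b : Fin (k + 1) → V)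
      (b' : Fin (k + 1) → V'), G.det ≠ 0 → IsBlock B F G M b → IsBlock B' F' G M b' →
      SkewIso B F B' F' := by
    intro k G M b b' hG hb hb'
    refine SkewIso.of_isBlock h h' hG hb hb' hχ fun P P' hP hP' hd _ _ hχ' => ?_
    rw [Fintype.card_fin, hn] at hd
    exact ih _ (by omega) rfl (h.restrict hP) (h'.restrict hP')
      (fun x hx => hB x (by simpa using hx)) (fun x hx => hB' x (by simpa using hx)) hχ'
  obtain ⟨v, hv, ⟨σ, hσ⟩ | ⟨θ, hθ, hFv, hpos⟩⟩ :=
    h.exists_eigenvector_or_rotation (AtMostOneNeg.of_pos hB)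
  · have hFv : F v = 0 := by
      have := h.self_map v
      rw [hσ, map_smul, smul_eq_mul, mul_eq_zero] at this
      rcases this with rfl | h0
      · simpa using hσ
      · exact absurd h0 (hB v hv).ne'
    obtain ⟨v', hv', hF2⟩ := exists_sq_eigenvector (F' := F') hχ hv (μ := 0) (by simp [hFv])
    have hFv' : F' v' = 0 := by
      by_contra h0
      have := hB' _ h0
      rw [h'.skew, hF2] at this
      simp at this
    exact step 0 1 _ _ _ (by simp)
      (isBlock_of_mem_ker hFv (inv_sqrt_mul_inv_sqrt_mul (hB v hv)))
      (isBlock_of_mem_ker hFv' (inv_sqrt_mul_inv_sqrt_mul (hB' v' hv')))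
  · obtain ⟨v', hv', hFv'⟩ := exists_sq_eigenvector (F' := F') hχ hv hFv
    exact step 1 _ _ _ _ (by simp) (h.isBlock_rotation hθ hFv hpos)
      (h'.isBlock_rotation hθ hFv' (hB' v' hv'))

end Riemannian

section Lorentzian

variable {V ι : Type*} [AddCommGroup V] [Module ℝ V] [Fintype ι]
  {B : LinearMap.BilinForm ℝ V} {F : V →ₗ[ℝ] V}

lemma AtMostOneNeg.pos_of_orthogonal (hB : AtMostOneNeg B) {t y : V} (ht : B t t < 0)
    (hy : y ≠ 0) (hty : B t y = 0) : 0 < B y y := by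
  by_contra! hneg
  have ht0 : t ≠ 0 := by
    rintro rfl
    simp at ht
  obtain ⟨c, rfl⟩ := hB t y ht0 ht.le hneg hty
  have : c ≠ 0 := by
    rintro rfl
    simp at hy
  simp [this, ht.ne] at hty

lemma AtMostOneNeg.not_degenerate (hB : AtMostOneNeg B) (hs : ∀ x y, B x y = B y x)
    (hv : ∃ v, F v = 0 ∧ B v v < 0) : ¬∃ v, v ≠ 0 ∧ F v = 0 ∧ ∀ w, F w = 0 → B v w = 0 := by
  rintro ⟨u, hu0, hu, hker⟩
  obtain ⟨v, hv, hvv⟩ := hv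
  exact (hB.pos_of_orthogonal hvv hu0 ((hs v u).trans (hker v hv))).ne' (hker u hu)

lemma AtMostOneNeg.eq_zero_of_forall (hB : AtMostOneNeg B) {t x : V} (ht : B t t < 0)
    (hx : ∀ y, B y x = 0) : x = 0 := by
  by_contra h0
  exact (hB.pos_of_orthogonal ht h0 (hx t)).ne' (hx x)

lemma IsBlock.pos_of_orthogonal {G M : Matrix ι ι ℝ} {b : ι → V} (hb : IsBlock B F G M b)
    (hB : AtMostOneNeg B) {c : ι → ℝ} (hc : c ⬝ᵥ G *ᵥ c < 0) {y : V} (hy : y ≠ 0)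
    (hby : ∀ i, B (b i) y = 0) : 0 < B y y := by
  refine hB.pos_of_orthogonal (t := ∑ i, c i • b i) ?_ hy (by simp [hby])
  convert hc using 1
  simp only [map_sum, LinearMap.sum_apply, map_smul, LinearMap.smul_apply, hb.gram, smul_eq_mul,
    dotProduct, mulVec, Finset.mul_sum]
  rw [Finset.sum_comm]
  exact Finset.sum_congr rfl fun i _ => Finset.sum_congr rfl fun j _ => by ring

lemma mem_range_of_forall_orthogonal [FiniteDimensional ℝ V] (hB : B.Nondegenerate)
    (hs : B.IsRefl) {T S : V →ₗ[ℝ] V} (hTS : ∀ x y, B (T x) y = B x (S y)) {u : V}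
    (hu : ∀ z, S z = 0 → B z u = 0) : u ∈ LinearMap.range T := by
  rw [← LinearMap.BilinForm.orthogonal_orthogonal hB hs (LinearMap.range T)]
  intro z hz
  refine hu z (hB.2 _ fun y => ?_)
  rw [← hTS]
  exact hz _ ⟨y, rfl⟩

lemma AtMostOneNeg.nondegenerate (hB : AtMostOneNeg B) (h : SkewPair B F) {t : V}
    (ht : B t t < 0) : B.Nondegenerate :=
  ⟨fun _ hx => hB.eq_zero_of_forall ht fun y => (h.symm y _).trans (hx y),
    fun _ hx => hB.eq_zero_of_forall ht hx⟩

lemma SkewPair.exists_neg_eigenvector [FiniteDimensional ℝ V] (h : SkewPair B F)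
    (hB : B.Nondegenerate) {v : V} {σ : ℝ} (hv : v ≠ 0) (hσ : F v = σ • v) :
    ∃ w ≠ 0, F w = -σ • w := by
  by_contra! hw
  have hinj : Function.Injective (F + σ • (LinearMap.id : V →ₗ[ℝ] V)) := by
    rw [← LinearMap.ker_eq_bot, LinearMap.ker_eq_bot']
    intro w h0
    by_contra hw0
    refine hw w hw0 ?_
    rw [neg_smul]
    exact eq_neg_of_add_eq_zero_left h0
  refine hv (hB.2 v fun y => ?_)
  obtain ⟨x, rfl⟩ := LinearMap.injective_iff_surjective.1 hinj y
  simp [h.skew, hσ]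

/-- A nonzero real eigenvalue gives a boost in a Lorentzian plane. -/
lemma SkewPair.exists_isBlock_boost [FiniteDimensional ℝ V] (h : SkewPair B F)
    (hB : AtMostOneNeg B) {t v : V} (ht : B t t < 0) {σ : ℝ} (hσ : σ ≠ 0) (hv : v ≠ 0)
    (hF : F v = σ • v) : ∃ b, IsBlock B F !![0, 1; 1, 0] !![σ, 0; 0, -σ] b := by
  have hnull : ∀ {x : V} {τ : ℝ}, τ ≠ 0 → F x = τ • x → B x x = 0 := by
    intro x τ hτ hx
    have := h.self_map x
    simpa [hx, hτ] using this
  obtain ⟨w, hw, hFw⟩ := h.exists_neg_eigenvector (hB.nondegenerate h ht) hv hF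
  have hvv := hnull hσ hF
  have hww := hnull (neg_ne_zero.2 hσ) hFw
  have hvw : B v w ≠ 0 := by
    intro h0
    obtain ⟨c, rfl⟩ := hB v w hv hvv.le hww.le h0
    rw [map_smul, hF, smul_smul, smul_smul, ← sub_eq_zero, ← sub_smul, smul_eq_zero] at hFw
    rcases hFw with h1 | h1
    · have : c = 0 := by
        have : 2 * σ * c = 0 := by linarith
        simpa [hσ] using this
      simp [this] at hw
    · exact hv h1
  refine ⟨![v, (B v w)⁻¹ • w], fun i j => ?_, fun i => ?_⟩
  · fin_cases i <;> fin_cases j <;> simp [hvv, hww, hvw, h.symm w v]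
  · fin_cases i
    · simp [hF]
    · simp [hFw, smul_smul, mul_comm]

/-- A degenerate kernel gives a null rotation in a three-dimensional Lorentzian subspace. -/
lemma SkewPair.exists_isBlock_nullRotation [FiniteDimensional ℝ V] (h : SkewPair B F)
    (hB : AtMostOneNeg B) {t v : V} (ht : B t t < 0) (hv : v ≠ 0) (hF : F v = 0)
    (hker : ∀ w, F w = 0 → B v w = 0) :
    ∃ b, IsBlock B F !![0, 0, -1; 0, 1, 0; -1, 0, 0] !![0, 1, 0; 0, 0, 1; 0, 0, 0] b := by
  have hnd := hB.nondegenerate h ht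
  have hvv := hker v hF
  obtain ⟨x, hx⟩ := mem_range_of_forall_orthogonal hnd h.isRefl (T := F) (S := -F) (u := v)
    (fun x y => by simp [h.skew]) fun z hz => by
      rw [h.symm]
      exact hker z (by simpa using hz)
  obtain ⟨w, hw⟩ := mem_range_of_forall_orthogonal hnd h.isRefl (T := F ∘ₗ F) (S := F ∘ₗ F)
    (u := v) (fun x y => by simp [h.skew]) fun z hz => by
      have hz' : F (F z) = 0 := hz
      obtain ⟨c, hc⟩ := hB v (F z) hv hvv.le (by rw [h.skew, hz']; simp) (hker _ hz')
      have hxv : B x v = 0 := by rw [← hx, h.self_map]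
      rw [h.symm, ← hx, h.skew, hc, map_smul, hxv]
      simp
  have hFw : F (F w) = v := hw
  have hpv : B (F w) v = 0 := by rw [← hFw, h.self_map]
  have hvp : B v (F w) = 0 := by rw [h.symm, hpv]
  have ha : 0 < B (F w) (F w) := by
    by_contra! hneg
    obtain ⟨c, hc⟩ := hB v (F w) hv hvv.le hneg hvp
    rw [hc, map_smul, hF, smul_zero] at hFw
    exact hv hFw.symm
  have hwv : B w v = -B (F w) (F w) := by
    rw [h.skew, hFw, neg_neg]
  have hvw : B v w = -B (F w) (F w) := by rw [h.symm, hwv]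
  have hwp := h.self_map w
  have hpw : B (F w) w = 0 := by rw [h.symm, hwp]
  set a := B (F w) (F w)
  set s := √a
  have hi : s⁻¹ * (s⁻¹ * B (F w) (F w)) = 1 := inv_sqrt_mul_inv_sqrt_mul ha
  refine ⟨![s⁻¹ • (w + (B w w / (2 * a)) • v), s⁻¹ • F w, s⁻¹ • v], fun i j => ?_, fun i => ?_⟩
  · have hd : B w w / (2 * a) * a = B w w / 2 := by field_simp
    fin_cases i <;> fin_cases j <;>
      simp [hvv, hpv, hvp, hwv, hvw, hwp, hpw, hi]
    · linear_combination (-2 * s⁻¹ * s⁻¹) * hd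
    all_goals exact hi
  · fin_cases i <;> simp [Fin.sum_univ_three, hF, hFw]

/-- A skew endomorphism of a Lorentzian space has a timelike kernel vector, a degenerate kernel,
or a nonzero real eigenvalue. -/
theorem SkewPair.trichotomy (n : ℕ) : ∀ {V : Type*} [AddCommGroup V] [Module ℝ V]
    [FiniteDimensional ℝ V] {B : LinearMap.BilinForm ℝ V} {F : V →ₗ[ℝ] V},
    Module.finrank ℝ V = n → SkewPair B F → AtMostOneNeg B → (∃ t, B t t < 0) →
    (∃ v, F v = 0 ∧ B v v < 0) ∨ (∃ v, v ≠ 0 ∧ F v = 0 ∧ ∀ w, F w = 0 → B v w = 0) ∨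
      ∃ σ : ℝ, σ ≠ 0 ∧ ∃ v, v ≠ 0 ∧ F v = σ • v := by
  induction n using Nat.strong_induction_on with
  | _ n ih =>
  intro V _ _ _ B F hn h hB ⟨t, ht⟩
  have hV : Nontrivial V := ⟨t, 0, by rintro rfl; simp at ht⟩
  have step : ∀ (k : ℕ) (M : Matrix (Fin (k + 1)) (Fin (k + 1)) ℝ) (b : Fin (k + 1) → V),
      IsBlock B F 1 M b →
      (∃ v, F v = 0 ∧ B v v < 0) ∨ (∃ v, v ≠ 0 ∧ F v = 0 ∧ ∀ w, F w = 0 → B v w = 0) ∨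
        ∃ σ : ℝ, σ ≠ 0 ∧ ∃ v, v ≠ 0 ∧ F v = σ • v := by
    intro k M b hb
    have hc := hb.isCompl h (by simp)
    have hW := hb.map_mem_span
    have hP := h.map_mem_orthogonal hW
    have hfin := Submodule.finrank_add_eq_of_isCompl hc
    rw [finrank_span_eq_card (hb.linearIndependent (by simp)), Fintype.card_fin, hn] at hfin
    have hpos : ∀ w ∈ Submodule.span ℝ (Set.range b), 0 ≤ B w w := by
      intro w hw
      obtain ⟨c, rfl⟩ := (Submodule.mem_span_range_iff_exists_fun ℝ).1 hw
      simp only [map_sum, LinearMap.sum_apply, map_smul, LinearMap.smul_apply, hb.gram,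
        Matrix.one_apply, smul_eq_mul, mul_ite, mul_one, mul_zero, Finset.sum_ite_eq',
        Finset.mem_univ, if_true]
      exact Finset.sum_nonneg fun i _ => mul_self_nonneg _
    set W := Submodule.span ℝ (Set.range b)
    have hdec : ∀ x : V, ∃ y ∈ W, ∃ z ∈ B.orthogonal W, y + z = x := fun x =>
      Submodule.mem_sup.1 (hc.sup_eq_top ▸ Submodule.mem_top)
    have hperp : ∀ y ∈ W, ∀ z ∈ B.orthogonal W, B y z = 0 := fun y hy z hz => hz y hy
    obtain ⟨y, hy, z, hz, rfl⟩ := hdec t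
    have hyz := hperp y hy z hz
    have hzz : B z z < 0 := by
      have h₁ := hpos y hy
      simp only [map_add, LinearMap.add_apply, hyz, h.symm z y] at ht
      linarith
    rcases ih _ (by omega) rfl (h.restrict hP) (hB.restrict _) ⟨⟨z, hz⟩, hzz⟩ with
      ⟨v, hv, hvv⟩ | ⟨v, hv0, hv, hker⟩ | ⟨σ, hσ, v, hv0, hv⟩
    · exact Or.inl ⟨v, congrArg Subtype.val hv, hvv⟩
    · refine Or.inr (Or.inl ⟨v, by simpa using hv0, congrArg Subtype.val hv, fun w hw => ?_⟩)
      obtain ⟨y, hy, z, hz, rfl⟩ := hdec w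
      have hFz : F z = 0 := by
        refine Submodule.disjoint_def.1 hc.disjoint _ ?_ (hP z hz)
        rw [map_add] at hw
        rw [eq_neg_of_add_eq_zero_right hw]
        exact W.neg_mem (hW y hy)
      have h₁ : B v z = 0 := hker ⟨z, hz⟩ (Subtype.ext hFz)
      rw [map_add, h₁, h.symm, hperp y hy v v.2, add_zero]
    · exact Or.inr (Or.inr ⟨σ, hσ, v, by simpa using hv0, congrArg Subtype.val hv⟩)
  obtain ⟨v, hv, ⟨σ, hσ⟩ | ⟨θ, hθ, hFv, hpos⟩⟩ := h.exists_eigenvector_or_rotation hB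
  · rcases ne_or_eq σ 0 with h0 | rfl
    · exact Or.inr (Or.inr ⟨σ, h0, v, hv, hσ⟩)
    rw [zero_smul] at hσ
    rcases lt_trichotomy (B v v) 0 with hneg | hnull | hpos
    · exact Or.inl ⟨v, hσ, hneg⟩
    · by_cases hker : ∀ w, F w = 0 → B v w = 0
      · exact Or.inr (Or.inl ⟨v, hv, hσ, hker⟩)
      · push Not at hker
        obtain ⟨w, hw, hvw⟩ := hker
        refine Or.inl ⟨w + (-(B w w + 1) / (2 * B v w)) • v, by simp [hw, hσ], ?_⟩
        have : -(B w w + 1) / (2 * B v w) * B v w = -(B w w + 1) / 2 := by field_simp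
        simp only [map_add, map_smul, LinearMap.add_apply, LinearMap.smul_apply, smul_eq_mul,
          hnull, h.symm w v, this]
        linarith
    · exact step 0 _ _ (isBlock_of_mem_ker hσ (inv_sqrt_mul_inv_sqrt_mul hpos))
  · exact step 1 _ _ (h.isBlock_rotation hθ hFv hpos)

end Lorentzian

section Classification

lemma SkewIso.symm {V V' : Type*} [AddCommGroup V] [Module ℝ V] [AddCommGroup V'] [Module ℝ V']
    {B : LinearMap.BilinForm ℝ V} {F : V →ₗ[ℝ] V}
    {B' : LinearMap.BilinForm ℝ V'} {F' : V' →ₗ[ℝ] V'} (h : SkewIso B F B' F') :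
    SkewIso B' F' B F := by
  obtain ⟨e, h₁, h₂⟩ := h
  refine ⟨e.symm, fun x y => ?_, fun x => ?_⟩
  · rw [← h₁, e.apply_symm_apply, e.apply_symm_apply]
  · rw [LinearEquiv.symm_apply_eq, h₂, e.apply_symm_apply]

lemma SkewIso.exists_timelike {V V' : Type*} [AddCommGroup V] [Module ℝ V] [AddCommGroup V']
    [Module ℝ V'] {B : LinearMap.BilinForm ℝ V} {F : V →ₗ[ℝ] V}
    {B' : LinearMap.BilinForm ℝ V'} {F' : V' →ₗ[ℝ] V'} (h : SkewIso B F B' F') :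
    (∃ v, F v = 0 ∧ B v v < 0) → ∃ v, F' v = 0 ∧ B' v v < 0 := by
  obtain ⟨e, h₁, h₂⟩ := h
  rintro ⟨v, hv, hvv⟩
  exact ⟨e v, by rw [← h₂, hv, map_zero], by rwa [h₁]⟩

lemma SkewIso.exists_degenerate {V V' : Type*} [AddCommGroup V] [Module ℝ V] [AddCommGroup V']
    [Module ℝ V'] {B : LinearMap.BilinForm ℝ V} {F : V →ₗ[ℝ] V}
    {B' : LinearMap.BilinForm ℝ V'} {F' : V' →ₗ[ℝ] V'} (h : SkewIso B F B' F') :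
    (∃ v, v ≠ 0 ∧ F v = 0 ∧ ∀ w, F w = 0 → B v w = 0) →
      ∃ v, v ≠ 0 ∧ F' v = 0 ∧ ∀ w, F' w = 0 → B' v w = 0 := by
  obtain ⟨e, h₁, h₂⟩ := h
  rintro ⟨v, hv0, hv, hker⟩
  refine ⟨e v, by simpa using hv0, by rw [← h₂, hv, map_zero], fun w hw => ?_⟩
  obtain ⟨w, rfl⟩ := e.surjective w
  rw [h₁]
  refine hker w (e.injective ?_)
  rw [h₂, hw, map_zero]

variable {V V' ι : Type*} [AddCommGroup V] [Module ℝ V] [FiniteDimensional ℝ V]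
  [AddCommGroup V'] [Module ℝ V'] [FiniteDimensional ℝ V'] [Fintype ι] [DecidableEq ι]
  {B : LinearMap.BilinForm ℝ V} {F : V →ₗ[ℝ] V}
  {B' : LinearMap.BilinForm ℝ V'} {F' : V' →ₗ[ℝ] V'}

/-- Once matching blocks containing a timelike vector are split off, what remains is the
Euclidean classification. -/
theorem SkewIso.of_isBlock_timelike (h : SkewPair B F) (h' : SkewPair B' F')
    (hB : AtMostOneNeg B) (hB' : AtMostOneNeg B')
    (hχ : (F ∘ₗ F).charpoly = (F' ∘ₗ F').charpoly) {G M : Matrix ι ι ℝ} {b : ι → V} {b' : ι → V'}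
    (hG : G.det ≠ 0) {c : ι → ℝ} (hc : c ⬝ᵥ G *ᵥ c < 0)
    (hb : IsBlock B F G M b) (hb' : IsBlock B' F' G M b') : SkewIso B F B' F' :=
  SkewIso.of_isBlock h h' hG hb hb' hχ fun _ _ hP hP' _ ho ho' hχ' =>
    SkewIso.of_pos _ rfl (h.restrict hP) (h'.restrict hP')
      (fun x hx => hb.pos_of_orthogonal hB hc (by simpa using hx) (ho x x.2))
      (fun x hx => hb'.pos_of_orthogonal hB' hc (by simpa using hx) (ho' x x.2)) hχ'

lemma SkewIso.of_timelike_ker (h : SkewPair B F) (h' : SkewPair B' F')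
    (hB : AtMostOneNeg B) (hB' : AtMostOneNeg B')
    (hχ : (F ∘ₗ F).charpoly = (F' ∘ₗ F').charpoly)
    (hv : ∃ v, F v = 0 ∧ B v v < 0) (hv' : ∃ v, F' v = 0 ∧ B' v v < 0) : SkewIso B F B' F' := by
  obtain ⟨v, hv, hvv⟩ := hv
  obtain ⟨v', hv', hvv'⟩ := hv'
  have key : ∀ {t : ℝ}, t < 0 → (√(-t))⁻¹ * ((√(-t))⁻¹ * t) = -1 := fun {t} ht => by
    rw [← inv_sqrt_mul_inv_sqrt_mul (neg_pos.2 ht)]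
    ring
  exact SkewIso.of_isBlock_timelike h h' hB hB' hχ (G := !![-1]) (c := ![1]) (by simp)
    (by simp [Matrix.mulVec, dotProduct])
    (isBlock_of_mem_ker hv (key hvv)) (isBlock_of_mem_ker hv' (key hvv'))

lemma SkewIso.of_degenerate_ker (h : SkewPair B F) (h' : SkewPair B' F')
    (hB : AtMostOneNeg B) (hB' : AtMostOneNeg B') (ht : ∃ t, B t t < 0) (ht' : ∃ t, B' t t < 0)
    (hχ : (F ∘ₗ F).charpoly = (F' ∘ₗ F').charpoly)
    (hv : ∃ v, v ≠ 0 ∧ F v = 0 ∧ ∀ w, F w = 0 → B v w = 0)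
    (hv' : ∃ v, v ≠ 0 ∧ F' v = 0 ∧ ∀ w, F' w = 0 → B' v w = 0) : SkewIso B F B' F' := by
  obtain ⟨t, ht⟩ := ht
  obtain ⟨t', ht'⟩ := ht'
  obtain ⟨v, hv0, hv, hker⟩ := hv
  obtain ⟨v', hv0', hv', hker'⟩ := hv'
  obtain ⟨b, hb⟩ := h.exists_isBlock_nullRotation hB ht hv0 hv hker
  obtain ⟨b', hb'⟩ := h'.exists_isBlock_nullRotation hB' ht' hv0' hv' hker'
  exact SkewIso.of_isBlock_timelike h h' hB hB' hχ (c := ![1, 0, 1])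
    (by simp [Matrix.det_fin_three]) (by simp [Matrix.mulVec, dotProduct, Fin.sum_univ_three]) hb hb'

lemma SkewIso.of_eigenvalue (h : SkewPair B F) (h' : SkewPair B' F')
    (hB : AtMostOneNeg B) (hB' : AtMostOneNeg B') (ht : ∃ t, B t t < 0) (ht' : ∃ t, B' t t < 0)
    (hχ : (F ∘ₗ F).charpoly = (F' ∘ₗ F').charpoly)
    (hσ : ∃ σ : ℝ, σ ≠ 0 ∧ ∃ v, v ≠ 0 ∧ F v = σ • v) : SkewIso B F B' F' := by
  obtain ⟨t, ht⟩ := ht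
  obtain ⟨t', ht'⟩ := ht'
  obtain ⟨σ, hσ, v, hv0, hv⟩ := hσ
  obtain ⟨v', hv0', hF2⟩ := exists_sq_eigenvector (F' := F') hχ hv0 (μ := σ ^ 2)
    (by rw [hv, map_smul, hv, smul_smul, pow_two])
  obtain ⟨u, hu0, hu⟩ : ∃ u ≠ 0, F' u = σ • u := by
    by_cases h0 : F' v' + σ • v' = 0
    · obtain ⟨u, hu0, hu⟩ := h'.exists_neg_eigenvector (hB'.nondegenerate h' ht') hv0'
        (σ := -σ) (by rw [neg_smul]; exact eq_neg_of_add_eq_zero_left h0)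
      exact ⟨u, hu0, by rwa [neg_neg] at hu⟩
    · refine ⟨_, h0, ?_⟩
      rw [map_add, map_smul, hF2]
      module
  obtain ⟨b, hb⟩ := h.exists_isBlock_boost hB ht hσ hv0 hv
  obtain ⟨b', hb'⟩ := h'.exists_isBlock_boost hB' ht' hσ hu0 hu
  exact SkewIso.of_isBlock_timelike h h' hB hB' hχ (c := ![1, -1])
    (by simp) (by simp [Matrix.mulVec, dotProduct]) hb hb'

/-- Skew endomorphisms of Lorentzian spaces are classified by the characteristic polynomial of
their squares together with the causal character of their kernels. -/
theorem SkewIso.of_lorentzian (h : SkewPair B F) (h' : SkewPair B' F')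
    (hB : AtMostOneNeg B) (hB' : AtMostOneNeg B') (ht : ∃ t, B t t < 0) (ht' : ∃ t, B' t t < 0)
    (hχ : (F ∘ₗ F).charpoly = (F' ∘ₗ F').charpoly)
    (hker : ((∃ v, F v = 0 ∧ B v v < 0) ↔ ∃ v, F' v = 0 ∧ B' v v < 0) ∨
      ((∃ v, v ≠ 0 ∧ F v = 0 ∧ ∀ w, F w = 0 → B v w = 0) ↔
        ∃ v, v ≠ 0 ∧ F' v = 0 ∧ ∀ w, F' w = 0 → B' v w = 0)) :
    SkewIso B F B' F' := by
  have hE := hB.not_degenerate (F := F) h.symm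
  have hE' := hB'.not_degenerate (F := F') h'.symm
  rcases h.trichotomy _ rfl hB ht with hv | hv | hv
  on_goal 3 => exact SkewIso.of_eigenvalue h h' hB hB' ht ht' hχ hv
  all_goals
    rcases h'.trichotomy _ rfl hB' ht' with hv' | hv' | hv'
    on_goal 3 => exact (SkewIso.of_eigenvalue h' h hB' hB ht' ht hχ.symm hv').symm
  · exact SkewIso.of_timelike_ker h h' hB hB' hχ hv hv'
  · exact (hker.elim (fun k => hE' (k.1 hv) hv') fun k => hE hv (k.2 hv')).elim
  · exact (hker.elim (fun k => hE (k.2 hv') hv) fun k => hE' hv' (k.1 hv)).elim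
  · exact SkewIso.of_degenerate_ker h h' hB hB' ht ht' hχ hv hv'

end Classification

section Minkowski

/-- The Minkowski form as a bilinear form. -/
noncomputable def minkForm (n : ℕ) : LinearMap.BilinForm ℝ (Fin (n + 2) → ℝ) :=
  LinearMap.mk₂ ℝ (mink n)
    (fun u u' v => by simp only [mink, Pi.add_apply, add_mul, Finset.sum_add_distrib]; ring)
    (fun c u v => by
      simp only [mink, Pi.smul_apply, smul_eq_mul, mul_assoc, ← Finset.mul_sum]; ring)
    (fun u v v' => by simp only [mink, Pi.add_apply, mul_add, Finset.sum_add_distrib]; ring)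
    (fun c u v => by
      simp only [mink, Pi.smul_apply, smul_eq_mul, mul_left_comm, ← Finset.mul_sum]; ring)

lemma minkForm_apply (n : ℕ) (u v : Fin (n + 2) → ℝ) : minkForm n u v = mink n u v := rfl

lemma mink_comm (n : ℕ) (u v : Fin (n + 2) → ℝ) : mink n u v = mink n v u := by
  simp only [mink, mul_comm]

lemma mink_single_self (n : ℕ) : mink n (Pi.single 0 1) (Pi.single 0 1) = -1 := by
  simp [mink]

lemma mink_single_right (n : ℕ) (u : Fin (n + 2) → ℝ) : mink n u (Pi.single 0 1) = -u 0 := by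
  simp [mink]

lemma eq_zero_of_mink_self_nonpos {n : ℕ} {z : Fin (n + 2) → ℝ} (h0 : z 0 = 0)
    (hz : mink n z z ≤ 0) : z = 0 := by
  simp only [mink, h0, mul_zero, neg_zero, zero_add] at hz
  have hs := (Finset.sum_eq_zero_iff_of_nonneg fun (i : Fin (n + 1)) _ =>
    mul_self_nonneg (z i.succ)).1 (hz.antisymm (Finset.sum_nonneg fun i _ => mul_self_nonneg _))
  ext i
  refine Fin.cases h0 (fun i => ?_) i
  simpa using hs i (Finset.mem_univ i)

lemma atMostOneNeg_minkForm (n : ℕ) : AtMostOneNeg (minkForm n) := by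
  intro x y hx hxx hyy hxy
  have hx0 : x 0 ≠ 0 := fun h0 => hx (eq_zero_of_mink_self_nonpos h0 hxx)
  refine ⟨y 0 / x 0, sub_eq_zero.1 (eq_zero_of_mink_self_nonpos ?_ ?_)⟩
  · simp [hx0]
  · have hyx : minkForm n y x = 0 := (mink_comm n y x).trans hxy
    rw [← minkForm_apply]
    simp only [map_sub, map_smul, LinearMap.sub_apply, LinearMap.smul_apply, smul_eq_mul, hxy, hyx]
    nlinarith [mul_nonneg (mul_self_nonneg (y 0 / x 0)) (neg_nonneg.2 hxx)]

lemma skewPair_minkForm {n : ℕ} {F : Matrix (Fin (n + 2)) (Fin (n + 2)) ℝ}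
    (hF : ∀ u v, mink n (F.mulVec u) v + mink n u (F.mulVec v) = 0) :
    SkewPair (minkForm n) (Matrix.toLin' F) :=
  ⟨mink_comm n, fun x y => eq_neg_of_add_eq_zero_left (hF x y)⟩

lemma charpoly_toLin'_comp_self {m : Type*} [Fintype m] [DecidableEq m] (F : Matrix m m ℝ) :
    (Matrix.toLin' F ∘ₗ Matrix.toLin' F).charpoly = (F * F).charpoly := by
  rw [← Matrix.toLin'_mul, Matrix.charpoly_toLin']

lemma SkewIso.of_matrix {n : ℕ} {F F' Λ : Matrix (Fin (n + 2)) (Fin (n + 2)) ℝ}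
    (hdet : IsUnit Λ.det) (hΛ : ∀ u v, mink n (Λ.mulVec u) (Λ.mulVec v) = mink n u v)
    (hF : F' = Λ * F * Λ⁻¹) :
    SkewIso (minkForm n) (Matrix.toLin' F) (minkForm n) (Matrix.toLin' F') := by
  refine ⟨Matrix.toLinearEquiv' Λ (Matrix.invertibleOfIsUnitDet Λ hdet), hΛ, fun x => ?_⟩
  change Λ *ᵥ (F *ᵥ x) = F' *ᵥ (Λ *ᵥ x)
  rw [hF, Matrix.mulVec_mulVec, Matrix.mulVec_mulVec, Matrix.nonsing_inv_mul_cancel_right _ _ hdet]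

lemma SkewIso.exists_orthochronous {n : ℕ} {F F' : Matrix (Fin (n + 2)) (Fin (n + 2)) ℝ}
    (h : SkewIso (minkForm n) (Matrix.toLin' F) (minkForm n) (Matrix.toLin' F')) :
    ∃ Λ : Matrix (Fin (n + 2)) (Fin (n + 2)) ℝ,
      IsUnit Λ.det ∧
      (∀ u v, mink n (Λ.mulVec u) (Λ.mulVec v) = mink n u v) ∧
      mink n (Λ.mulVec (Pi.single 0 1)) (Pi.single 0 1) < 0 ∧
      F' = Λ * F * Λ⁻¹ := by
  obtain ⟨e, h₁, h₂⟩ := h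
  set L := LinearMap.toMatrix' e.toLinearMap with hL
  have hLe : ∀ x, L *ᵥ x = e x := fun x => LinearMap.toMatrix'_mulVec e.toLinearMap x
  have hdet : IsUnit L.det := by
    rw [hL, LinearMap.det_toMatrix']
    exact e.isUnit_det'
  have hmul : L * F = F' * L := by
    refine Matrix.toLin'.injective (LinearMap.ext fun x => ?_)
    simp only [Matrix.toLin'_apply, ← Matrix.mulVec_mulVec, hLe]
    exact h₂ x
  have hconj : F' = L * F * L⁻¹ := by
    rw [hmul, Matrix.mul_nonsing_inv_cancel_right _ _ hdet]
  have hiso : ∀ u v, mink n (L.mulVec u) (L.mulVec v) = mink n u v := fun u v => by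
    rw [hLe, hLe]
    exact h₁ u v
  have hne : mink n (L.mulVec (Pi.single 0 1)) (Pi.single 0 1) ≠ 0 := by
    intro h0
    have hself := (hiso (Pi.single 0 1) (Pi.single 0 1)).trans (mink_single_self n)
    rw [mink_single_right, neg_eq_zero] at h0
    rw [eq_zero_of_mink_self_nonpos h0 (by rw [hself]; norm_num)] at hself
    simp [mink] at hself
  rcases hne.lt_or_gt with hlt | hgt
  · exact ⟨L, hdet, hiso, hlt, hconj⟩
  · have hneg : ∀ x, (-L) *ᵥ x = -(L *ᵥ x) := fun x => Matrix.neg_mulVec x L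
    have hinv : (-L)⁻¹ = -L⁻¹ := by
      refine Matrix.inv_eq_right_inv ?_
      rw [neg_mul_neg, Matrix.mul_nonsing_inv _ hdet]
    refine ⟨-L, ?_, fun u v => ?_, ?_, ?_⟩
    · rw [Matrix.det_neg]
      exact (isUnit_one.neg.pow _).mul hdet
    · simp only [hneg, ← minkForm_apply, map_neg, LinearMap.neg_apply, neg_neg]
      exact hiso u v
    · rw [mink_single_right] at hgt
      rw [hneg, mink_single_right, Pi.neg_apply, neg_neg]
      linarith
    · rw [hinv, neg_mul, neg_mul_neg]
      exact hconj

end Minkowski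

/-- two `η`-skew-symmetric endomorphisms `F, F'` of `ℝ^{n+2}` are conjugate
by an orthochronous Lorentz transformation if and only if `F²` and `F'²` have the same
characteristic polynomial and (for `n` odd) `ker F` contains a timelike vector exactly
when `ker F'` does, while (for `n` even) `η` restricted to `ker F` is degenerate exactly
when `η` restricted to `ker F'` is. -/
theorem stmt3 (n : ℕ) (hn : 1 ≤ n)
    (F F' : Matrix (Fin (n + 2)) (Fin (n + 2)) ℝ)
    (hF : ∀ u v, mink n (F.mulVec u) v + mink n u (F.mulVec v) = 0)
    (hF' : ∀ u v, mink n (F'.mulVec u) v + mink n u (F'.mulVec v) = 0) :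
    (∃ Λ : Matrix (Fin (n + 2)) (Fin (n + 2)) ℝ,
      IsUnit Λ.det ∧
      (∀ u v, mink n (Λ.mulVec u) (Λ.mulVec v) = mink n u v) ∧
      mink n (Λ.mulVec (Pi.single 0 1)) (Pi.single 0 1) < 0 ∧
      F' = Λ * F * Λ⁻¹)
    ↔
    ((F * F).charpoly = (F' * F').charpoly ∧
      (Odd n →
        ((∃ v, F.mulVec v = 0 ∧ mink n v v < 0) ↔
         (∃ v, F'.mulVec v = 0 ∧ mink n v v < 0))) ∧
      (Even n →
        ((∃ v, v ≠ 0 ∧ F.mulVec v = 0 ∧ ∀ w, F.mulVec w = 0 → mink n v w = 0) ↔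
         (∃ v, v ≠ 0 ∧ F'.mulVec v = 0 ∧ ∀ w, F'.mulVec w = 0 → mink n v w = 0)))) := by
  have hχ : (F * F).charpoly = (F' * F').charpoly ↔
      (Matrix.toLin' F ∘ₗ Matrix.toLin' F).charpoly =
        (Matrix.toLin' F' ∘ₗ Matrix.toLin' F').charpoly := by
    rw [charpoly_toLin'_comp_self, charpoly_toLin'_comp_self]
  rw [hχ]
  constructor
  · rintro ⟨Λ, hdet, hΛ, -, hconj⟩
    have e := SkewIso.of_matrix hdet hΛ hconj
    exact ⟨e.charpoly_eq, fun _ => ⟨e.exists_timelike, e.symm.exists_timelike⟩,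
      fun _ => ⟨e.exists_degenerate, e.symm.exists_degenerate⟩⟩
  · rintro ⟨hχ, hodd, heven⟩
    have ht : ∃ t, minkForm n t t < 0 :=
      ⟨Pi.single 0 1, by rw [minkForm_apply, mink_single_self]; norm_num⟩
    exact (SkewIso.of_lorentzian (skewPair_minkForm hF) (skewPair_minkForm hF')
      (atMostOneNeg_minkForm n) (atMostOneNeg_minkForm n) ht ht hχ
      ((Nat.even_or_odd n).symm.imp hodd heven)).exists_orthochronous
end

section
/- Let n ≥ 2 be even, let S be the set of η-skew-symmetric endomorphisms of ℝ^{n+2} with the conjugation action of the orthochronous Lorentz group O⁺(1,n+1), and give the orbit space S/O⁺(1,n+1) the quotient topology. Let c : S → ℝ be the degree-0 coefficient of the characteristic polynomial. Then the image in the orbit space of the set {F ∈ S : c(F) < 0} is dense in S/O⁺(1,n+1). -/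
open Matrix

/-- `η`-skew-symmetric endomorphisms of `ℝ^{n+2}`. -/
def EtaSkew (n : ℕ) (F : Matrix (Fin (n + 2)) (Fin (n + 2)) ℝ) : Prop :=
  ∀ u v, mink n (F.mulVec u) v + mink n u (F.mulVec v) = 0

/-- Orthochronous Lorentz transformations of `ℝ^{n+2}`. -/
def OrthoLorentz (n : ℕ) (Λ : Matrix (Fin (n + 2)) (Fin (n + 2)) ℝ) : Prop :=
  IsUnit Λ.det ∧ (∀ u v, mink n (Λ.mulVec u) (Λ.mulVec v) = mink n u v) ∧
    mink n (Λ.mulVec (Pi.single 0 1)) (Pi.single 0 1) < 0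

/-- The conjugation relation on `η`-skew-symmetric endomorphisms induced by the action
of the orthochronous Lorentz group. -/
def conjRel (n : ℕ)
    (F F' : {F : Matrix (Fin (n + 2)) (Fin (n + 2)) ℝ // EtaSkew n F}) : Prop :=
  ∃ Λ, OrthoLorentz n Λ ∧ F'.1 = Λ * F.1 * Λ⁻¹

open Filter Topology

/-- The matrix of the Minkowski form. -/
noncomputable def minkMatrix (n : ℕ) : Matrix (Fin (n + 2)) (Fin (n + 2)) ℝ :=
  diagonal (Fin.cons (-1) fun _ => 1)

theorem mink_eq_dotProduct (n : ℕ) (u v : Fin (n + 2) → ℝ) :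
    mink n u v = u ⬝ᵥ minkMatrix n *ᵥ v := by
  simp [mink, minkMatrix, dotProduct, mulVec_diagonal, Fin.sum_univ_succ (n := n + 1)]

theorem minkMatrix_mul_self (n : ℕ) : minkMatrix n * minkMatrix n = 1 := by
  rw [minkMatrix, diagonal_mul_diagonal, ← diagonal_one]
  congr 1
  ext i
  cases i using Fin.cases <;> simp

theorem det_minkMatrix (n : ℕ) : (minkMatrix n).det = -1 := by
  simp [minkMatrix, Fin.prod_univ_succ (n := n + 1)]

theorem etaSkew_iff (n : ℕ) (F : Matrix (Fin (n + 2)) (Fin (n + 2)) ℝ) :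
    EtaSkew n F ↔ (minkMatrix n * F)ᵀ = -(minkMatrix n * F) := by
  have hT : (minkMatrix n)ᵀ = minkMatrix n := diagonal_transpose _
  have key (u v) : mink n (F *ᵥ u) v + mink n u (F *ᵥ v) =
      u ⬝ᵥ ((minkMatrix n * F)ᵀ + minkMatrix n * F) *ᵥ v := by
    rw [mink_eq_dotProduct, mink_eq_dotProduct, add_mulVec, dotProduct_add, transpose_mul, hT,
      ← mulVec_mulVec, ← mulVec_mulVec, dotProduct_mulVec u Fᵀ, vecMul_transpose]
  rw [← add_eq_zero_iff_eq_neg]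
  constructor
  · intro h
    ext i j
    have := h (Pi.single i 1) (Pi.single j 1)
    rw [key] at this
    simpa using this
  · intro h u v
    rw [key, h]
    simp

/-- A real skew-symmetric matrix has nonnegative determinant. -/
theorem det_nonneg_of_transpose_eq_neg {ι : Type*} [Fintype ι] [DecidableEq ι]
    {A : Matrix ι ι ℝ} (hA : Aᵀ = -A) : 0 ≤ A.det := by
  cases isEmpty_or_nonempty ι
  · simp
  have hquad (v : ι → ℝ) : v ⬝ᵥ A *ᵥ v = 0 := by
    have h : v ⬝ᵥ A *ᵥ v = -(v ⬝ᵥ A *ᵥ v) := by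
      conv_lhs => rw [dotProduct_mulVec, ← mulVec_transpose, hA, dotProduct_comm]
      simp [neg_mulVec]
    linarith
  have heval (t : ℝ) : (-A).charpoly.eval t = (scalar ι t + A).det := by
    rw [eval_charpoly, sub_neg_eq_add]
  have hne (t : ℝ) (ht : 0 < t) : (-A).charpoly.eval t ≠ 0 := by
    rw [heval]
    intro h0
    obtain ⟨v, hv, hv0⟩ := exists_mulVec_eq_zero_iff.2 h0
    have h1 : v ⬝ᵥ (scalar ι t + A) *ᵥ v = t * (v ⬝ᵥ v) := by
      rw [add_mulVec, dotProduct_add, hquad, scalar_apply, ← smul_one_eq_diagonal]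
      simp [smul_mulVec]
    rw [hv0, dotProduct_zero] at h1
    rcases mul_eq_zero.1 h1.symm with h | h
    · exact ht.ne' h
    · exact hv (dotProduct_self_eq_zero.1 h)
  have h0 : (-A).charpoly.eval 0 = A.det := by simp [heval]
  by_contra! hneg
  have htop : Tendsto (fun t => (-A).charpoly.eval t) atTop atTop := by
    refine Polynomial.tendsto_atTop_of_leadingCoeff_nonneg _ ?_ ?_
    · rw [charpoly_degree_eq_dim]
      exact_mod_cast Fintype.card_pos
    · rw [(charpoly_monic _).leadingCoeff]
      exact zero_le_one
  obtain ⟨T, hT, hT0⟩ := ((htop.eventually_ge_atTop 0).and (eventually_gt_atTop 0)).exists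
  obtain ⟨t, ht, hte⟩ := intermediate_value_Icc hT0.le
    (Polynomial.continuous (-A).charpoly).continuousOn (Set.mem_Icc.2 ⟨h0 ▸ hneg.le, hT⟩)
  rcases ht.1.eq_or_lt with rfl | ht0
  · exact hneg.ne (h0 ▸ hte)
  · exact hne t ht0 hte

theorem exists_transpose_eq_neg_isUnit_det {N : ℕ} (hN : Even N) :
    ∃ K : Matrix (Fin N) (Fin N) ℝ, Kᵀ = -K ∧ IsUnit K.det := by
  obtain ⟨m, rfl⟩ := hN
  refine ⟨reindex finSumFinEquiv finSumFinEquiv (J (Fin m) ℝ), ?_, ?_⟩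
  · rw [transpose_reindex, J_transpose]
    rfl
  · rw [det_reindex_self]
    exact isUnit_det_J _ _

/-- A small generic perturbation along an invertible matrix is invertible. -/
theorem eventually_det_add_smul_ne_zero {ι : Type*} [Fintype ι] [DecidableEq ι]
    (A : Matrix ι ι ℝ) {K : Matrix ι ι ℝ} (hK : IsUnit K.det) :
    ∀ᶠ t in 𝓝[≠] (0 : ℝ), (A + t • K).det ≠ 0 := by
  set p := (-(K⁻¹ * A)).charpoly
  have hp : p ≠ 0 := (charpoly_monic _).ne_zero
  have hev : ∀ᶠ t in 𝓝[≠] (0 : ℝ), t ∉ {t | p.IsRoot t} :=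
    (Polynomial.finite_setOfPred_isRoot hp).eventually_cofinite_notMem.filter_mono
      (nhdsNE_le_cofinite 0)
  filter_upwards [hev] with t ht h0
  apply ht
  have hfac : A + t • K = K * (scalar ι t - -(K⁻¹ * A)) := by
    rw [sub_neg_eq_add, mul_add, mul_nonsing_inv_cancel_left _ _ hK, add_comm]
    simp [← smul_one_eq_diagonal]
  rw [hfac, det_mul] at h0
  change p.eval t = 0
  rw [eval_charpoly]
  exact (mul_eq_zero.1 h0).resolve_left hK.ne_zero

theorem charpoly_coeff_zero_neg {n : ℕ} (hn : Even n)
    {F : Matrix (Fin (n + 2)) (Fin (n + 2)) ℝ} (hF : EtaSkew n F)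
    (hdet : (minkMatrix n * F).det ≠ 0) : F.charpoly.coeff 0 < 0 := by
  have hpos := (det_nonneg_of_transpose_eq_neg ((etaSkew_iff n F).1 hF)).lt_of_ne' hdet
  rw [det_mul, det_minkMatrix, det_eq_sign_charpoly_coeff, Fintype.card_fin,
    (hn.add even_two).neg_one_pow] at hpos
  linarith

theorem dense_charpoly_coeff_zero_neg {n : ℕ} (hn : Even n) :
    Dense {F : {F : Matrix (Fin (n + 2)) (Fin (n + 2)) ℝ // EtaSkew n F} |
      F.1.charpoly.coeff 0 < 0} := by
  intro F
  obtain ⟨K, hKT, hK⟩ := exists_transpose_eq_neg_isUnit_det (hn.add even_two)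
  have hmul (t : ℝ) : minkMatrix n * (F.1 + t • (minkMatrix n * K)) =
      minkMatrix n * F.1 + t • K := by
    rw [mul_add, Matrix.mul_smul, ← mul_assoc, minkMatrix_mul_self, one_mul]
  have hskew (t : ℝ) : EtaSkew n (F.1 + t • (minkMatrix n * K)) := by
    rw [etaSkew_iff, hmul, transpose_add, transpose_smul, (etaSkew_iff n F.1).1 F.2, hKT,
      smul_neg, neg_add]
  have hcont : Continuous fun t : ℝ => (⟨_, hskew t⟩ : {F // EtaSkew n F}) :=
    Continuous.subtype_mk (by fun_prop) _
  have hlim : Tendsto (fun t : ℝ => (⟨_, hskew t⟩ : {F // EtaSkew n F})) (𝓝[≠] 0) (𝓝 F) := by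
    have h := hcont.tendsto 0
    simp only [zero_smul, add_zero, Subtype.coe_eta] at h
    exact h.mono_left nhdsWithin_le_nhds
  refine mem_closure_of_tendsto hlim ?_
  filter_upwards [eventually_det_add_smul_ne_zero (minkMatrix n * F.1) hK] with t ht
  exact charpoly_coeff_zero_neg hn (hskew t) (by rwa [hmul])

/-- for `n ≥ 2` even, the image in the orbit space (with the quotient
topology) of the set of `η`-skew-symmetric endomorphisms whose characteristic polynomial
has negative degree-0 coefficient is dense. -/
theorem stmt5 (n : ℕ) (hn : 2 ≤ n) (hne : Even n) :
    Dense (Quot.mk (conjRel n) '' {F | (Matrix.charpoly F.1).coeff 0 < 0}) := by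
  exact Quot.mk_surjective.denseRange.dense_image continuous_quot_mk
    (dense_charpoly_coeff_zero_neg hne)
end

section
/- Let n ≥ 2, let U ⊆ ℝⁿ be open, and let Y be a smooth conformal Killing vector field of the Euclidean metric on U with Y(x) ≠ 0 for all x ∈ U. Define the symmetric-2-tensor-valued field D on U by D_{ij} := |Y|^{−(n+2)} ( Y_i Y_j − (|Y|²/n) δ_{ij} ). Then D is trace-free, ∑_i D_{ii} = 0, and divergence-free: ∑_i ∂_i D_{ij} = 0 on U for every j. (That is, D = D_Y is a TT tensor.) -/
/-- The weighted trace-free square `|y|^{-(n+2)} (y ⊗ y - (|y|²/n) Id)`, differentiated along `v`. -/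
theorem fderiv_tracefree_square_div_apply {E : Type*} [NormedAddCommGroup E] [NormedSpace ℝ E]
    {n : ℕ} {Y : E → Fin n → ℝ} {x : E}
    (hY : ∀ k, DifferentiableAt ℝ (fun z => Y z k) x) (hS : 0 < ∑ k, Y x k ^ 2)
    (i j : Fin n) (δ : ℝ) (v : E) :
    fderiv ℝ (fun z => (Y z i * Y z j - ((∑ k, Y z k ^ 2) / (n : ℝ)) * δ)
        / (Real.sqrt (∑ k, Y z k ^ 2)) ^ (n + 2)) x v
      = ((fderiv ℝ (fun z => Y z i) x v * Y x j + Y x i * fderiv ℝ (fun z => Y z j) x v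
            - 2 * (∑ k, Y x k * fderiv ℝ (fun z => Y z k) x v) / n * δ) * (∑ k, Y x k ^ 2)
          - (Y x i * Y x j - ((∑ k, Y x k ^ 2) / (n : ℝ)) * δ) * (n + 2)
            * ∑ k, Y x k * fderiv ℝ (fun z => Y z k) x v)
        / (Real.sqrt (∑ k, Y x k ^ 2)) ^ (n + 4) := by
  have hsq : HasFDerivAt (fun z => ∑ k, Y z k ^ 2)
      ((2 : ℝ) • ∑ k, Y x k • fderiv ℝ (fun z => Y z k) x) x := by
    rw [Finset.smul_sum]
    refine HasFDerivAt.fun_sum fun k _ => ?_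
    exact ((hY k).hasFDerivAt.pow 2).congr_fderiv (by ext w; simp [mul_assoc])
  have hr : 0 < Real.sqrt (∑ k, Y x k ^ 2) := Real.sqrt_pos.mpr hS
  have hrr : Real.sqrt (∑ k, Y x k ^ 2) ^ 2 = ∑ k, Y x k ^ 2 := Real.sq_sqrt hS.le
  have hden := (hsq.sqrt hS.ne').pow (n + 2)
  have hnum := ((hY i).hasFDerivAt.mul (hY j).hasFDerivAt).sub
    ((hsq.mul_const (n : ℝ)⁻¹).mul_const δ)
  have h := hnum.mul ((hasDerivAt_inv (pow_pos hr (n + 2)).ne').comp_hasFDerivAt x hden)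
  have e : (fun z => (Y z i * Y z j - ((∑ k, Y z k ^ 2) / (n : ℝ)) * δ)
        / (Real.sqrt (∑ k, Y z k ^ 2)) ^ (n + 2)) = _ := funext fun z => div_eq_mul_inv _ _
  rw [e]
  refine (congrArg (fun L => L v) h.fderiv).trans ?_
  simp only [add_apply, sub_apply,
    smul_apply, sum_apply, smul_eq_mul, Pi.mul_apply,
    Pi.sub_apply, Function.comp_apply, nsmul_eq_mul]
  generalize (∑ k, Y x k * fderiv ℝ (fun z => Y z k) x v) = P
  generalize Real.sqrt (∑ k, Y x k ^ 2) = r at *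
  rw [← hrr]
  push_cast
  simp only [pow_add]
  field_simp
  ring

/-- The algebraic identity behind `div (|Y|^{-(n+2)} (Y ⊗ Y - (|Y|²/n) Id)) = 0`, where `A` is the
Jacobian matrix of `Y`. -/
theorem sum_divergence_numerator_eq_zero {n : ℕ} (hn : n ≠ 0) (y : Fin n → ℝ)
    (A : Fin n → Fin n → ℝ)
    (hA : ∀ i j, A i j + A j i = (2 / (n : ℝ)) * (∑ k, A k k) * (if i = j then 1 else 0))
    (j : Fin n) :
    ∑ i, ((A i i * y j + y i * A j i
            - 2 * (∑ k, y k * A k i) / n * (if i = j then 1 else 0)) * (∑ k, y k ^ 2)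
          - (y i * y j - ((∑ k, y k ^ 2) / (n : ℝ)) * (if i = j then 1 else 0)) * (n + 2)
            * ∑ k, y k * A k i) = 0 := by
  have hn' : (n : ℝ) ≠ 0 := by exact_mod_cast hn
  set S := ∑ k, y k ^ 2 with hS
  set t := ∑ k, A k k with ht
  set P : Fin n → ℝ := fun i => ∑ k, y k * A k i with hP
  have hrow : ∀ j, ∑ i, y i * A j i = 2 / n * t * y j - P j := by
    intro j
    rw [eq_sub_iff_add_eq, hP, ← Finset.sum_add_distrib]
    simp only [← mul_add, hA]
    simp [mul_comm]
  have hyP : ∑ i, y i * P i = t * S / n := by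
    have h1 : ∑ i, y i * P i = ∑ j, y j * ∑ i, y i * A j i := by
      simp only [hP, Finset.mul_sum]
      rw [Finset.sum_comm]
      exact Finset.sum_congr rfl fun _ _ => Finset.sum_congr rfl fun _ _ => by ring
    have h2 : ∑ j, y j * ∑ i, y i * A j i = 2 / n * t * S - ∑ i, y i * P i := by
      simp only [hrow, hS, Finset.mul_sum, ← Finset.sum_sub_distrib]
      exact Finset.sum_congr rfl fun _ _ => by ring
    have h3 := h1.trans h2
    field_simp at h3 ⊢
    linarith
  have hsplit : ∀ i, (A i i * y j + y i * A j i - 2 * P i / n * (if i = j then 1 else 0)) * S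
        - (y i * y j - (S / (n : ℝ)) * (if i = j then 1 else 0)) * (n + 2) * P i
      = S * y j * A i i + S * (y i * A j i) - (n + 2) * y j * (y i * P i)
        + (if i = j then S * P i else 0) := by
    intro i
    split_ifs
    · field_simp
      ring
    · ring
  refine (Finset.sum_congr rfl fun i _ => hsplit i).trans ?_
  rw [Finset.sum_add_distrib, Finset.sum_sub_distrib, Finset.sum_add_distrib, ← Finset.mul_sum,
    ← Finset.mul_sum, ← Finset.mul_sum, hrow, hyP, ← ht]
  simp only [Finset.sum_ite_eq', Finset.mem_univ, if_true]
  field_simp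
  ring

/-- if `Y` is a smooth, nowhere-vanishing conformal Killing vector field of
the Euclidean metric on an open set `U ⊆ ℝⁿ`, then
`D := |Y|^{−(n+2)} (Y ⊗ Y − (|Y|²/n) Id)` is trace-free and divergence-free on `U`. -/
theorem stmt7 (n : ℕ) (hn : 2 ≤ n) (U : Set (Fin n → ℝ)) (hU : IsOpen U)
    (Y : (Fin n → ℝ) → (Fin n → ℝ)) (hYsmooth : ContDiffOn ℝ (⊤ : ℕ∞) Y U)
    (hY0 : ∀ x ∈ U, Y x ≠ 0)
    (hCKV : ∀ x ∈ U, ∀ i j,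
      fderiv ℝ (fun z => Y z i) x (Pi.single j 1)
        + fderiv ℝ (fun z => Y z j) x (Pi.single i 1)
      = (2 / (n : ℝ)) * (∑ k, fderiv ℝ (fun z => Y z k) x (Pi.single k 1))
          * (if i = j then 1 else 0))
    (D : (Fin n → ℝ) → Fin n → Fin n → ℝ)
    (hD : ∀ x i j, D x i j =
      (Y x i * Y x j - ((∑ k, Y x k ^ 2) / (n : ℝ)) * (if i = j then 1 else 0))
        / (Real.sqrt (∑ k, Y x k ^ 2)) ^ (n + 2)) :
    (∀ x ∈ U, ∑ i, D x i i = 0) ∧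
    (∀ x ∈ U, ∀ j, ∑ i, fderiv ℝ (fun z => D z i j) x (Pi.single i 1) = 0) := by
  have hn0 : n ≠ 0 := by lia
  have hn' : (n : ℝ) ≠ 0 := by exact_mod_cast hn0
  refine ⟨fun x _ => ?_, fun x hx j => ?_⟩
  · simp only [hD, ← Finset.sum_div, if_true, mul_one, Finset.sum_sub_distrib, ← sq]
    simp [mul_div_cancel_left₀ _ hn']
  · have hdiff : ∀ k, DifferentiableAt ℝ (fun z => Y z k) x :=
      differentiableAt_pi.mp <|
        (hYsmooth.contDiffAt (hU.mem_nhds hx)).differentiableAt (by simp)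
    have hS : 0 < ∑ k, Y x k ^ 2 := by
      obtain ⟨k, hk⟩ := Function.ne_iff.mp (hY0 x hx)
      exact Finset.sum_pos' (fun _ _ => sq_nonneg _) ⟨k, Finset.mem_univ _, sq_pos_of_ne_zero hk⟩
    simp only [hD, fderiv_tracefree_square_div_apply hdiff hS, ← Finset.sum_div]
    rw [sum_divergence_numerator_eq_zero hn0 (Y x)
      (fun i j => fderiv ℝ (fun z => Y z i) x (Pi.single j 1)) (hCKV x hx) j, zero_div]
end

section
/- Let n ≥ 2, let U ⊆ ℝⁿ be open, let f : U → ℝ be smooth and positive, and let y : U → ℝⁿ be smooth with |y(x)| = 1 for all x ∈ U. Define L := div y, a := Dy[y] (the derivative of y in the direction y), h := Id − y yᵀ, S := (1/2)(Dy + Dyᵀ), and Π := h S h − (L/(n−1)) h. Then the vector field Y := f·y is a conformal Killing vector field of the Euclidean metric on U if and only if ∇f = (fL/(n−1))·y − f·a and Π = 0 on U. -/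
open Finset in
/-- Compression of a bilinear form `S` by the projection `Id - y yᵀ`, entrywise. -/
theorem sum_projection_compression {ι : Type*} [Fintype ι] [DecidableEq ι]
    (y : ι → ℝ) (S : ι → ι → ℝ) (i j : ι) :
    ∑ k, ∑ l, ((if i = k then 1 else 0) - y i * y k) * S k l *
        ((if l = j then 1 else 0) - y l * y j)
      = S i j - (∑ l, S i l * y l) * y j - y i * (∑ k, y k * S k j)
        + y i * (∑ k, y k * ∑ l, S k l * y l) * y j := by
  have inner (k : ι) : ∑ l, ((if i = k then 1 else 0) - y i * y k) * S k l *
        ((if l = j then 1 else 0) - y l * y j)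
      = ((if i = k then 1 else 0) - y i * y k) * (S k j - (∑ l, S k l * y l) * y j) := by
    simp only [mul_assoc, ← mul_sum]
    congr 1
    simp only [mul_sub, sum_sub_distrib, mul_ite, mul_one, mul_zero, sum_ite_eq', mem_univ,
      if_true, sum_mul, mul_assoc]
  simp only [inner]
  simp only [sub_mul, sum_sub_distrib, ite_mul, one_mul, zero_mul, sum_ite_eq, mem_univ,
    if_true]
  simp only [mul_sub, sum_sub_distrib, mul_sum, sum_mul, mul_assoc]
  ring

open Finset in
/-- The pointwise algebra behind the kinematic decomposition: `M` plays the role of the Jacobian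
of a unit field `y`, `g` and `F` those of the gradient and the value of a positive function, and
`L` that of the divergence of `y`. -/
theorem conformal_killing_iff_kinematic {ι : Type*} [Fintype ι] [DecidableEq ι]
    {ν F : ℝ} (L : ℝ) {y : ι → ℝ} (g : ι → ℝ) {M : ι → ι → ℝ}
    (hν : ν ≠ 0) (hν1 : ν - 1 ≠ 0) (hF : F ≠ 0)
    (hy : ∑ i, y i ^ 2 = 1) (hM : ∀ j, ∑ i, y i * M i j = 0) :
    (∀ i j, (g j * y i + F * M i j) + (g i * y j + F * M j i)
        = 2 / ν * (∑ k, g k * y k + F * L) * (if i = j then 1 else 0)) ↔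
      (∀ i, g i = F * L / (ν - 1) * y i - F * ∑ j, M i j * y j) ∧
      (∀ i j, (∑ k, ∑ l, ((if i = k then 1 else 0) - y i * y k) * ((M k l + M l k) / 2) *
          ((if l = j then 1 else 0) - y l * y j))
        - L / (ν - 1) * ((if i = j then 1 else 0) - y i * y j) = 0) := by
  set a : ι → ℝ := fun i => ∑ j, M i j * y j with ha
  have hya : ∑ i, y i * a i = 0 := by
    simp only [ha, mul_sum]
    rw [sum_comm]
    simp only [← mul_assoc, ← sum_mul, hM, zero_mul, sum_const_zero]
  have hSr (k : ι) : ∑ l, (M k l + M l k) / 2 * y l = a k / 2 := by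
    have := hM k
    calc ∑ l, (M k l + M l k) / 2 * y l
        = (∑ l, M k l * y l + ∑ l, y l * M l k) / 2 := by
          rw [← sum_add_distrib, sum_div]; exact sum_congr rfl fun _ _ => by ring
      _ = a k / 2 := by rw [this, add_zero]
  have hSl (k : ι) : ∑ l, y l * ((M l k + M k l) / 2) = a k / 2 := by
    rw [← hSr k]; exact sum_congr rfl fun _ _ => by ring
  have hSS : ∑ k, y k * (a k / 2) = 0 := by
    simp only [← mul_div_assoc, ← sum_div, hya, zero_div]
  have hP (i j : ι) : (∑ k, ∑ l, ((if i = k then 1 else 0) - y i * y k) *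
        ((M k l + M l k) / 2) * ((if l = j then 1 else 0) - y l * y j))
      = (M i j + M j i) / 2 - a i / 2 * y j - y i * (a j / 2) := by
    rw [sum_projection_compression y (fun k l => (M k l + M l k) / 2)]
    simp only [hSr, hSl, hSS]
    ring
  simp only [hP, show ∀ i, ∑ j, M i j * y j = a i from fun _ => rfl]
  set c := ∑ k, g k * y k with hc
  constructor
  · intro H
    have hrow (i : ι) : c * y i + g i + F * a i = 2 / ν * (c + F * L) * y i := by
      have h1 : ∑ j, ((g j * y i + F * M i j) + (g i * y j + F * M j i)) * y j
          = ∑ j, 2 / ν * (c + F * L) * (if i = j then 1 else 0) * y j :=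
        sum_congr rfl fun j _ => by rw [H]
      have h2 : ∑ j, ((g j * y i + F * M i j) + (g i * y j + F * M j i)) * y j
          = c * y i + F * a i + g i * ∑ j, y j ^ 2 + F * ∑ j, y j * M j i := by
        simp only [hc, ha, mul_sum, sum_mul, ← sum_add_distrib]
        exact sum_congr rfl fun _ _ => by ring
      simp only [h2, hy, hM, mul_ite, mul_one, mul_zero, ite_mul, zero_mul, sum_ite_eq, mem_univ,
        if_true] at h1
      linarith
    have hcontr : c + c = 2 / ν * (c + F * L) := by
      have h1 : ∑ i, (c * y i + g i + F * a i) * y i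
          = ∑ i, 2 / ν * (c + F * L) * y i * y i := sum_congr rfl fun i _ => by rw [hrow]
      have h2 : ∑ i, (c * y i + g i + F * a i) * y i
          = c * ∑ i, y i ^ 2 + ∑ k, g k * y k + F * ∑ i, y i * a i := by
        rw [mul_sum, mul_sum, ← sum_add_distrib, ← sum_add_distrib]
        exact sum_congr rfl fun _ _ => by ring
      have h3 : ∑ i, 2 / ν * (c + F * L) * y i * y i
          = 2 / ν * (c + F * L) * ∑ i, y i ^ 2 := by
        rw [mul_sum]; exact sum_congr rfl fun _ _ => by ring
      rw [h2, h3, hy, hya, ← hc] at h1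
      linarith
    have hcval : c = F * L / (ν - 1) := by
      field_simp at hcontr ⊢
      linarith
    have hg (i : ι) : g i = c * y i - F * a i := by
      have := hrow i
      rw [← hcontr] at this
      linarith
    refine ⟨fun i => by rw [← hcval]; exact hg i, fun i j => ?_⟩
    have hij := H i j
    rw [← hcontr, hg i, hg j] at hij
    have hLc : F * (L / (ν - 1)) = c := by rw [hcval]; ring
    refine (mul_eq_zero.mp ?_).resolve_left hF
    linear_combination hij / 2 - ((if i = j then 1 else 0) - y i * y j) * hLc
  · rintro ⟨hg, hPi⟩ i j
    have hcval : c = F * L / (ν - 1) := by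
      have : c = F * L / (ν - 1) * ∑ k, y k ^ 2 - F * ∑ k, y k * a k := by
        simp only [hc, mul_sum, ← sum_sub_distrib]
        exact sum_congr rfl fun k _ => by rw [hg k]; ring
      rw [this, hy, hya]; ring
    have hcontr : 2 / ν * (c + F * L) = 2 * c := by
      rw [hcval]; field_simp; ring
    have hLc : F * (L / (ν - 1)) = c := by rw [hcval]; ring
    rw [hcontr, hg i, hg j, ← hcval]
    linear_combination 2 * F * hPi i j + 2 * ((if i = j then 1 else 0) - y i * y j) * hLc

/-- A unit vector field is orthogonal to each of its directional derivatives. -/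
theorem sum_mul_fderiv_eq_zero_of_unit {ι E : Type*} [Fintype ι] [NormedAddCommGroup E]
    [NormedSpace ℝ E] {U : Set E} (hU : IsOpen U) {y : E → ι → ℝ} {x : E} (hx : x ∈ U)
    (hy : ∀ i, DifferentiableAt ℝ (fun z => y z i) x)
    (hyunit : ∀ z ∈ U, ∑ i, y z i ^ 2 = 1) (v : E) :
    ∑ i, y x i * fderiv ℝ (fun z => y z i) x v = 0 := by
  have h1 : HasFDerivAt (fun z => ∑ i, y z i ^ 2)
      (∑ i, (2 * y x i) • fderiv ℝ (fun z => y z i) x) x :=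
    HasFDerivAt.fun_sum fun i _ => by simpa using (hy i).hasFDerivAt.pow 2
  have h2 : HasFDerivAt (fun z => ∑ i, y z i ^ 2) (0 : E →L[ℝ] ℝ) x :=
    (hasFDerivAt_const (1 : ℝ) x).congr_of_eventuallyEq <|
      Filter.eventually_of_mem (hU.mem_nhds hx) hyunit
  have h3 := DFunLike.congr_fun (h1.unique h2) v
  simp only [sum_apply, smul_apply, smul_eq_mul,
    zero_apply, mul_assoc, ← Finset.mul_sum] at h3
  simpa using h3


/-- let `f > 0` and `y` with `|y| = 1` be smooth on an open `U ⊆ ℝⁿ`, and set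
`L := div y`, `a := Dy[y]`, `h := Id − y yᵀ`, `S := (Dy + Dyᵀ)/2` and
`Π := h S h − (L/(n−1)) h`. Then `Y := f·y` is a conformal Killing vector field of the
Euclidean metric on `U` if and only if `∇f = (fL/(n−1)) y − f a` and `Π = 0` on `U`. -/
theorem stmt8 (n : ℕ) (hn : 2 ≤ n) (U : Set (Fin n → ℝ)) (hU : IsOpen U)
    (f : (Fin n → ℝ) → ℝ) (y : (Fin n → ℝ) → (Fin n → ℝ))
    (hf : ContDiffOn ℝ (⊤ : ℕ∞) f U) (hfpos : ∀ x ∈ U, 0 < f x)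
    (hy : ContDiffOn ℝ (⊤ : ℕ∞) y U) (hyunit : ∀ x ∈ U, ∑ i, y x i ^ 2 = 1)
    (Dy : (Fin n → ℝ) → Fin n → Fin n → ℝ)
    (hDy : ∀ x i j, Dy x i j = fderiv ℝ (fun z => y z i) x (Pi.single j 1))
    (L : (Fin n → ℝ) → ℝ) (hL : ∀ x, L x = ∑ i, Dy x i i)
    (a : (Fin n → ℝ) → Fin n → ℝ) (ha : ∀ x i, a x i = ∑ j, Dy x i j * y x j)
    (h : (Fin n → ℝ) → Fin n → Fin n → ℝ)
    (hh : ∀ x i j, h x i j = (if i = j then 1 else 0) - y x i * y x j)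
    (S : (Fin n → ℝ) → Fin n → Fin n → ℝ)
    (hS : ∀ x i j, S x i j = (Dy x i j + Dy x j i) / 2)
    (P : (Fin n → ℝ) → Fin n → Fin n → ℝ)
    (hP : ∀ x i j, P x i j =
      (∑ k, ∑ l, h x i k * S x k l * h x l j) - (L x / ((n : ℝ) - 1)) * h x i j) :
    (∀ x ∈ U, ∀ i j,
      fderiv ℝ (fun z => f z * y z i) x (Pi.single j 1)
        + fderiv ℝ (fun z => f z * y z j) x (Pi.single i 1)
      = (2 / (n : ℝ)) * (∑ k, fderiv ℝ (fun z => f z * y z k) x (Pi.single k 1))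
          * (if i = j then 1 else 0))
    ↔
    (∀ x ∈ U,
      (∀ i, fderiv ℝ f x (Pi.single i 1)
        = (f x * L x / ((n : ℝ) - 1)) * y x i - f x * a x i) ∧
      (∀ i j, P x i j = 0)) := by
  have hn' : (2 : ℝ) ≤ n := by exact_mod_cast hn
  refine forall₂_congr fun x hx => ?_
  have hfx : DifferentiableAt ℝ f x :=
    (hf.contDiffAt (hU.mem_nhds hx)).differentiableAt (by simp)
  have hyx : ∀ i, DifferentiableAt ℝ (fun z => y z i) x :=
    differentiableAt_pi.mp ((hy.contDiffAt (hU.mem_nhds hx)).differentiableAt (by simp))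
  have hprod (i j : Fin n) : fderiv ℝ (fun z => f z * y z i) x (Pi.single j 1)
      = fderiv ℝ f x (Pi.single j 1) * y x i + f x * Dy x i j := by
    rw [fderiv_fun_mul hfx (hyx i), hDy]
    simp only [add_apply, smul_apply, smul_eq_mul]
    ring
  have horth (j : Fin n) : ∑ i, y x i * Dy x i j = 0 := by
    simp only [hDy]
    exact sum_mul_fderiv_eq_zero_of_unit hU hx hyx hyunit _
  simp only [hprod, hP, hh, hS, ha, Finset.sum_add_distrib, ← Finset.mul_sum, ← hL]
  exact conformal_killing_iff_kinematic (L x) (fun i => fderiv ℝ f x (Pi.single i 1))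
    (by linarith) (by linarith) (hfpos x hx).ne' (hyunit x hx) horth
end

section
/- Let n ≥ 2, let U ⊆ ℝⁿ be open, let f : U → ℝ be smooth and positive, and let y : U → ℝⁿ be smooth with |y(x)| = 1 for all x ∈ U. Set L := div y, a := Dy[y], and define the tensor field D on U by D_{αβ} := f^{−n} ( y_α y_β − (1/n) δ_{αβ} ). Then the divergence of D vanishes, i.e. ∑_α ∂_α D_{αβ} = 0 on U for every β, if and only if ∇f = (fL/(n−1))·y − f·a on U. -/
/-- Directional derivative of `(u v - c) / f ^ n`. -/
theorem fderiv_mul_sub_const_div_pow_apply {E : Type*} [NormedAddCommGroup E] [NormedSpace ℝ E]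
    {n : ℕ} (hn : n ≠ 0) {u v f : E → ℝ} {x : E} (hu : DifferentiableAt ℝ u x)
    (hv : DifferentiableAt ℝ v x) (hf : DifferentiableAt ℝ f x) (hx : f x ≠ 0) (c : ℝ) (e : E) :
    fderiv ℝ (fun z => (u z * v z - c) / f z ^ n) x e =
      ((fderiv ℝ u x e * v x + u x * fderiv ℝ v x e) * f x
        - n * fderiv ℝ f x e * (u x * v x - c)) / f x ^ (n + 1) := by
  obtain ⟨m, rfl⟩ := Nat.exists_eq_succ_of_ne_zero hn
  have hinv : HasFDerivAt (fun z => (f z ^ (m + 1))⁻¹) _ x :=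
    ((hasDerivAt_pow (m + 1) (f x)).fun_inv (pow_ne_zero _ hx)).comp_hasFDerivAt x hf.hasFDerivAt
  have h := ((hu.hasFDerivAt.fun_mul hv.hasFDerivAt).sub_const c).fun_mul hinv
  simp only [Nat.succ_eq_add_one, div_eq_mul_inv _ (f _ ^ (m + 1))]
  rw [h.fderiv]
  simp
  field_simp
  ring

/-- A unit vector field is orthogonal to each of its directional derivatives. -/
theorem sum_mul_fderiv_eq_zero_of_sum_sq_eq_one {E ι : Type*} [NormedAddCommGroup E]
    [NormedSpace ℝ E] [Fintype ι] {U : Set E} (hU : IsOpen U) {y : E → ι → ℝ}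
    (hunit : ∀ x ∈ U, ∑ i, y x i ^ 2 = 1) {x : E} (hx : x ∈ U)
    (hy : ∀ i, DifferentiableAt ℝ (fun z => y z i) x) (e : E) :
    ∑ i, y x i * fderiv ℝ (fun z => y z i) x e = 0 := by
  have h := HasFDerivAt.fun_sum (u := Finset.univ)
    fun i _ => HasFDerivAt.pow (hy i).hasFDerivAt 2
  have hc : (fun z => ∑ i, y z i ^ 2) =ᶠ[nhds x] fun _ => (1 : ℝ) := by
    filter_upwards [hU.mem_nhds hx] with z hz using hunit z hz
  have h0 := h.unique ((hasFDerivAt_const (1 : ℝ) x).congr_of_eventuallyEq hc)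
  have h1 := congrArg (fun T => T e) h0
  simp [mul_assoc, ← Finset.mul_sum] at h1
  exact h1

/-- For a unit vector `y` and `a` orthogonal to `y`, the linear equation
`f (l y + a) = n ⟨y, g⟩ y - g` has the unique solution `g = (f l / (n - 1)) y - f a`. -/
theorem forall_eq_zero_iff_eq_smul_sub {ι : Type*} [Fintype ι] {y a g : ι → ℝ} {f l n : ℝ}
    (hn : n - 1 ≠ 0) (hy : ∑ i, y i ^ 2 = 1) (ha : ∑ i, y i * a i = 0) :
    (∀ j, f * (l * y j + a j) - n * (∑ i, y i * g i) * y j + g j = 0) ↔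
      ∀ j, g j = f * l / (n - 1) * y j - f * a j := by
  have key : ∑ i, y i * g i = f * l / (n - 1) →
      ∀ j, f * (l * y j + a j) - n * (∑ i, y i * g i) * y j + g j =
        g j - (f * l / (n - 1) * y j - f * a j) := by
    intro hs j
    rw [hs]
    field_simp
    ring
  constructor
  · intro h
    have hs : ∑ j, y j * (f * (l * y j + a j) - n * (∑ i, y i * g i) * y j + g j) =
        (f * l - n * ∑ i, y i * g i) * ∑ j, y j ^ 2 + f * ∑ j, y j * a j
          + ∑ j, y j * g j := by
      simp only [Finset.mul_sum (s := Finset.univ) (a := f),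
        Finset.mul_sum (s := Finset.univ) (a := f * l - n * ∑ i, y i * g i),
        ← Finset.sum_add_distrib]
      exact Finset.sum_congr rfl fun j _ => by ring
    simp only [h, mul_zero, Finset.sum_const_zero, hy, ha] at hs
    have hs' : ∑ i, y i * g i = f * l / (n - 1) := by
      rw [eq_div_iff hn]
      linarith
    intro j
    exact sub_eq_zero.mp ((key hs' j).symm.trans (h j))
  · intro h
    have hs : ∑ i, y i * g i = f * l / (n - 1) * ∑ i, y i ^ 2 - f * ∑ i, y i * a i := by
      rw [Finset.mul_sum, Finset.mul_sum, ← Finset.sum_sub_distrib]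
      exact Finset.sum_congr rfl fun j _ => by rw [h j]; ring
    rw [hy, ha] at hs
    intro j
    rw [key (by linarith) j, ← h j, sub_self]


/-- let `f > 0` and `y` with `|y| = 1` be smooth on an open `U ⊆ ℝⁿ`, and set
`L := div y`, `a := Dy[y]`, `D := f^{−n} (y ⊗ y − (1/n) Id)`. Then the divergence of `D`
vanishes on `U` if and only if `∇f = (fL/(n−1)) y − f a` on `U`. -/
theorem stmt9 (n : ℕ) (hn : 2 ≤ n) (U : Set (Fin n → ℝ)) (hU : IsOpen U)
    (f : (Fin n → ℝ) → ℝ) (y : (Fin n → ℝ) → (Fin n → ℝ))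
    (hf : ContDiffOn ℝ (⊤ : ℕ∞) f U) (hfpos : ∀ x ∈ U, 0 < f x)
    (hy : ContDiffOn ℝ (⊤ : ℕ∞) y U) (hyunit : ∀ x ∈ U, ∑ i, y x i ^ 2 = 1)
    (Dy : (Fin n → ℝ) → Fin n → Fin n → ℝ)
    (hDy : ∀ x i j, Dy x i j = fderiv ℝ (fun z => y z i) x (Pi.single j 1))
    (L : (Fin n → ℝ) → ℝ) (hL : ∀ x, L x = ∑ i, Dy x i i)
    (a : (Fin n → ℝ) → Fin n → ℝ) (ha : ∀ x i, a x i = ∑ j, Dy x i j * y x j)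
    (D : (Fin n → ℝ) → Fin n → Fin n → ℝ)
    (hD : ∀ x i j, D x i j =
      (y x i * y x j - (1 / (n : ℝ)) * (if i = j then 1 else 0)) / f x ^ n) :
    (∀ x ∈ U, ∀ j, ∑ i, fderiv ℝ (fun z => D z i j) x (Pi.single i 1) = 0)
    ↔
    (∀ x ∈ U, ∀ i, fderiv ℝ f x (Pi.single i 1)
      = (f x * L x / ((n : ℝ) - 1)) * y x i - f x * a x i) := by
  have hn0 : (n : ℝ) ≠ 0 := by positivity
  have hn1 : (n : ℝ) - 1 ≠ 0 := by
    have : (2 : ℝ) ≤ n := by exact_mod_cast hn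
    linarith
  refine forall₂_congr fun x hx => ?_
  have hfx := (hfpos x hx).ne'
  have hfd : DifferentiableAt ℝ f x :=
    (hf.contDiffAt (hU.mem_nhds hx)).differentiableAt (by simp)
  have hyd : ∀ i, DifferentiableAt ℝ (fun z => y z i) x :=
    differentiableAt_pi.mp ((hy.contDiffAt (hU.mem_nhds hx)).differentiableAt (by simp))
  have horth : ∑ i, y x i * a x i = 0 := by
    simp only [ha, Finset.mul_sum]
    rw [Finset.sum_comm]
    refine Finset.sum_eq_zero fun j _ => ?_
    have h := sum_mul_fderiv_eq_zero_of_sum_sq_eq_one hU hyunit hx hyd (Pi.single j 1)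
    simp only [← hDy] at h
    simp only [← mul_assoc, ← Finset.sum_mul, h, zero_mul]
  rw [← forall_eq_zero_iff_eq_smul_sub hn1 (hyunit x hx) horth]
  refine forall_congr' fun j => ?_
  have hdiv : ∑ i, fderiv ℝ (fun z => D z i j) x (Pi.single i 1) =
      (f x * (L x * y x j + a x j)
        - n * (∑ i, y x i * fderiv ℝ f x (Pi.single i 1)) * y x j
        + fderiv ℝ f x (Pi.single j 1)) / f x ^ (n + 1) := by
    have hδ : fderiv ℝ f x (Pi.single j 1) =
        ∑ i, fderiv ℝ f x (Pi.single i 1) * (if i = j then 1 else 0) := by simp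
    rw [hδ, hL, ha]
    simp only [Finset.sum_mul, Finset.mul_sum, ← Finset.sum_add_distrib,
      ← Finset.sum_sub_distrib, Finset.sum_div]
    refine Finset.sum_congr rfl fun i _ => ?_
    simp only [hD]
    rw [fderiv_mul_sub_const_div_pow_apply (by omega) (hyd i) (hyd j) hfd hfx, ← hDy, ← hDy]
    congr 1
    field_simp
    ring
  rw [hdiv, div_eq_zero_iff, or_iff_left (pow_ne_zero _ hfx)]
end

section
/- Let n ≥ 4 be even, p = n/2 − 1, λ > 0 and b₁,…,b_p ∈ ℝ with every b_i ≠ 0. Let F be the endomorphism of ℝ^{n+2} defined by F(e₀) = F(e₁) = (1/(2√λ)) e₂, F(e₂) = (1/(2√λ))(e₀ − e₁), F(e₃) = 0, and, for i = 1,…,p, F(e_{2i+2}) = b_i e_{2i+3} and F(e_{2i+3}) = −b_i e_{2i+2}. Then F is η-skew-symmetric, ker F = span{e₀ − e₁, e₃} and the restriction of η to ker F is positive semidefinite and degenerate (e₀ − e₁ is a null vector in ker F), and the characteristic polynomial of −F² equals X⁴ ∏_{i=1}^{p} (X − b_i²)². -/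
open Polynomial

/-- The index splitting `{0, 1, 2, 3} ⊔ ⨆ᵢ {2i + 4, 2i + 5}` of the coordinates of `ℝ^{2p+4}`. -/
def coordEquiv (p : ℕ) : Fin 4 ⊕ (Fin p × Fin 2) ≃ Fin (2 * p + 2 + 2) :=
  ((Equiv.refl _).sumCongr finProdFinEquiv).trans
    (finSumFinEquiv.trans (finCongr (by omega)))

theorem coordEquiv_inl_zero (p : ℕ) : coordEquiv p (.inl 0) = 0 := by
  ext; simp [coordEquiv]

theorem coordEquiv_inl_one (p : ℕ) : coordEquiv p (.inl 1) = 1 := by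
  ext; simp [coordEquiv]

theorem coordEquiv_inl_two (p : ℕ) : coordEquiv p (.inl 2) = 2 := by
  ext
  rw [Fin.val_two]
  simp [coordEquiv]

theorem coordEquiv_inl_three (p : ℕ) (hp : 1 ≤ p) : coordEquiv p (.inl 3) = 3 := by
  ext
  have h : ((3 : Fin (2 * p + 2 + 2)) : ℕ) = 3 :=
    Nat.mod_eq_of_lt (show 3 < 2 * p + 2 + 2 by omega)
  rw [h]
  simp [coordEquiv]

theorem coordEquiv_inr_zero (p : ℕ) (i : Fin p) :
    coordEquiv p (.inr (i, 0)) = ⟨2 * (i : ℕ) + 4, by have := i.isLt; omega⟩ := by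
  ext; simp [coordEquiv]; omega

theorem coordEquiv_inr_one (p : ℕ) (i : Fin p) :
    coordEquiv p (.inr (i, 1)) = ⟨2 * (i : ℕ) + 5, by have := i.isLt; omega⟩ := by
  ext; simp [coordEquiv]; omega

theorem sum_coordEquiv {M : Type*} [AddCommMonoid M] (p : ℕ) (f : Fin (2 * p + 2 + 2) → M) :
    ∑ k, f k = f (coordEquiv p (.inl 0)) + f (coordEquiv p (.inl 1)) + f (coordEquiv p (.inl 2))
      + f (coordEquiv p (.inl 3))
      + ∑ i, (f (coordEquiv p (.inr (i, 0))) + f (coordEquiv p (.inr (i, 1)))) := by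
  rw [← (coordEquiv p).sum_comp, Fintype.sum_sum_type, Fintype.sum_prod_type]
  simp [Fin.sum_univ_four]

theorem mink_coordEquiv (p : ℕ) (u v : Fin (2 * p + 2 + 2) → ℝ) :
    mink (2 * p + 2) u v =
      -(u (coordEquiv p (.inl 0)) * v (coordEquiv p (.inl 0)))
      + u (coordEquiv p (.inl 1)) * v (coordEquiv p (.inl 1))
      + u (coordEquiv p (.inl 2)) * v (coordEquiv p (.inl 2))
      + u (coordEquiv p (.inl 3)) * v (coordEquiv p (.inl 3))
      + ∑ i, (u (coordEquiv p (.inr (i, 0))) * v (coordEquiv p (.inr (i, 0)))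
        + u (coordEquiv p (.inr (i, 1))) * v (coordEquiv p (.inr (i, 1)))) := by
  have h := sum_coordEquiv p fun k => u k * v k
  rw [Fin.sum_univ_succ, coordEquiv_inl_zero] at h
  rw [mink, coordEquiv_inl_zero]
  linarith

/-- The matrix of `F` with respect to the splitting `coordEquiv`. -/
def splitMatrix {p : ℕ} (c : ℝ) (b : Fin p → ℝ) :
    Matrix (Fin 4 ⊕ (Fin p × Fin 2)) (Fin 4 ⊕ (Fin p × Fin 2)) ℝ
  | .inl k, .inl l => !![0, 0, c, 0; 0, 0, -c, 0; c, c, 0, 0; 0, 0, 0, 0] k l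
  | .inr (i, k), .inr (j, l) => if i = j then !![0, -b i; b i, 0] k l else 0
  | .inl _, .inr _ => 0
  | .inr _, .inl _ => 0

theorem charpoly_neg_splitMatrix_sq {p : ℕ} (c : ℝ) (b : Fin p → ℝ) :
    (-(splitMatrix c b * splitMatrix c b)).charpoly
      = X ^ 4 * ∏ i : Fin p, (X - C (b i ^ 2)) ^ 2 := by
  have h : -(splitMatrix c b * splitMatrix c b) = Matrix.fromBlocks
      !![-c ^ 2, -c ^ 2, 0, 0; c ^ 2, c ^ 2, 0, 0; 0, 0, 0, 0; 0, 0, 0, 0] 0 0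
      (Matrix.diagonal fun x : Fin p × Fin 2 => b x.1 ^ 2) := by
    ext k l
    rw [Matrix.neg_apply, Matrix.mul_apply, Fintype.sum_sum_type, Fintype.sum_prod_type]
    rcases k with k | ⟨i, k⟩ <;> rcases l with l | ⟨j, l⟩
    · fin_cases k <;> fin_cases l <;> simp [splitMatrix, Fin.sum_univ_four] <;> ring
    · simp [splitMatrix]
    · simp [splitMatrix]
    · by_cases hij : i = j
      · subst hij
        fin_cases k <;> fin_cases l <;> simp [splitMatrix] <;> ring
      · fin_cases k <;> fin_cases l <;> simp [splitMatrix, hij, Matrix.diagonal]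
  rw [h, Matrix.charpoly_fromBlocks_zero₁₂, Matrix.charpoly_diagonal, Fintype.prod_prod_type]
  congr 1
  · simp [Matrix.charpoly, Matrix.charmatrix, Matrix.det_succ_row_zero, Fin.sum_univ_succ,
      Fin.succAbove]
    ring
  · simp [sq]

/-- for `n = 2p + 2` even (`n ≥ 4`), `λ > 0`, all `bᵢ ≠ 0`, and `F` defined
by `F(e₀) = F(e₁) = (1/(2√λ)) e₂`, `F(e₂) = (1/(2√λ))(e₀ − e₁)`, `F(e₃) = 0`,
`F(e_{2i+2}) = bᵢ e_{2i+3}`, `F(e_{2i+3}) = −bᵢ e_{2i+2}` (`i = 1,…,p`): `F` is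
`η`-skew-symmetric, `ker F = span{e₀ − e₁, e₃}`, `η` restricted to `ker F` is positive
semidefinite and degenerate (`e₀ − e₁` is a null vector in `ker F`), and the
characteristic polynomial of `−F²` equals `X⁴ ∏ᵢ (X − bᵢ²)²`. -/
theorem stmt11 (p : ℕ) (hp : 1 ≤ p) (n : ℕ) (hn : n = 2 * p + 2)
    (lam : ℝ) (hlam : 0 < lam) (b : Fin p → ℝ) (hb : ∀ i, b i ≠ 0)
    (F : Matrix (Fin (n + 2)) (Fin (n + 2)) ℝ)
    (hF0 : F.mulVec (Pi.single 0 1)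
      = (1 / (2 * Real.sqrt lam)) • (Pi.single 2 1 : Fin (n + 2) → ℝ))
    (hF1 : F.mulVec (Pi.single 1 1)
      = (1 / (2 * Real.sqrt lam)) • (Pi.single 2 1 : Fin (n + 2) → ℝ))
    (hF2 : F.mulVec (Pi.single 2 1)
      = (1 / (2 * Real.sqrt lam)) •
          ((Pi.single 0 1 : Fin (n + 2) → ℝ) - Pi.single 1 1))
    (hF3 : F.mulVec (Pi.single 3 1) = 0)
    (hFx : ∀ i : Fin p,
      F.mulVec (Pi.single ⟨2 * (i : ℕ) + 4, by have := i.isLt; omega⟩ 1)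
        = b i • (Pi.single ⟨2 * (i : ℕ) + 5, by have := i.isLt; omega⟩ 1 :
            Fin (n + 2) → ℝ))
    (hFy : ∀ i : Fin p,
      F.mulVec (Pi.single ⟨2 * (i : ℕ) + 5, by have := i.isLt; omega⟩ 1)
        = (-(b i)) • (Pi.single ⟨2 * (i : ℕ) + 4, by have := i.isLt; omega⟩ 1 :
            Fin (n + 2) → ℝ)) :
    (∀ u v, mink n (F.mulVec u) v + mink n u (F.mulVec v) = 0) ∧
    LinearMap.ker F.mulVecLin
      = Submodule.span ℝ
          {(Pi.single 0 1 : Fin (n + 2) → ℝ) - Pi.single 1 1,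
            (Pi.single 3 1 : Fin (n + 2) → ℝ)} ∧
    (∀ v ∈ LinearMap.ker F.mulVecLin, 0 ≤ mink n v v) ∧
    ((Pi.single 0 1 : Fin (n + 2) → ℝ) - Pi.single 1 1) ∈ LinearMap.ker F.mulVecLin ∧
    ((Pi.single 0 1 : Fin (n + 2) → ℝ) - Pi.single 1 1) ≠ 0 ∧
    mink n ((Pi.single 0 1 : Fin (n + 2) → ℝ) - Pi.single 1 1)
      ((Pi.single 0 1 : Fin (n + 2) → ℝ) - Pi.single 1 1) = 0 ∧
    (∀ w ∈ LinearMap.ker F.mulVecLin,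
      mink n ((Pi.single 0 1 : Fin (n + 2) → ℝ) - Pi.single 1 1) w = 0) ∧
    (-(F * F)).charpoly = X ^ 4 * ∏ i : Fin p, (X - C (b i ^ 2)) ^ 2 := by
  subst hn
  set c := 1 / (2 * Real.sqrt lam) with hc
  have hc0 : c ≠ 0 := by positivity
  have hF : F.submatrix (coordEquiv p) (coordEquiv p) = splitMatrix c b := by
    simp only [← coordEquiv_inl_zero p, ← coordEquiv_inl_one p, ← coordEquiv_inl_two p,
      ← coordEquiv_inl_three p hp, ← coordEquiv_inr_zero p, ← coordEquiv_inr_one p,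
      Matrix.mulVec_single_one] at hF0 hF1 hF2 hF3 hFx hFy
    ext k l
    have key : F.submatrix (coordEquiv p) (coordEquiv p) k l
        = F.col (coordEquiv p l) (coordEquiv p k) := rfl
    rw [key]
    rcases l with l | ⟨j, l⟩
    · fin_cases l <;> rcases k with k | ⟨i, k⟩ <;> fin_cases k <;>
        simp [-Matrix.col_apply, hF0, hF1, hF2, hF3, splitMatrix]
    · fin_cases l <;> rcases k with k | ⟨i, k⟩ <;> fin_cases k <;>
        simp [-Matrix.col_apply, hFx, hFy, splitMatrix, Pi.single_apply] <;> grind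
  have hmul : ∀ v k, F.mulVec v (coordEquiv p k)
      = (splitMatrix c b).mulVec (v ∘ coordEquiv p) k := by
    intro v k
    rw [← hF, Matrix.submatrix_mulVec_equiv]
    simp [Function.comp_assoc]
  have h0 : ∀ v, F.mulVec v (coordEquiv p (.inl 0)) = c * v (coordEquiv p (.inl 2)) := by
    intro v
    rw [hmul]
    simp [Matrix.mulVec, dotProduct, splitMatrix, Fin.sum_univ_four]
  have h1 : ∀ v, F.mulVec v (coordEquiv p (.inl 1)) = -(c * v (coordEquiv p (.inl 2))) := by
    intro v
    rw [hmul]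
    simp [Matrix.mulVec, dotProduct, splitMatrix, Fin.sum_univ_four]
  have h2 : ∀ v, F.mulVec v (coordEquiv p (.inl 2))
      = c * (v (coordEquiv p (.inl 0)) + v (coordEquiv p (.inl 1))) := by
    intro v
    rw [hmul]
    simp [Matrix.mulVec, dotProduct, splitMatrix, Fin.sum_univ_four, mul_add]
  have h3 : ∀ v, F.mulVec v (coordEquiv p (.inl 3)) = 0 := by
    intro v
    rw [hmul]
    simp [Matrix.mulVec, dotProduct, splitMatrix, Fin.sum_univ_four]
  have hx : ∀ v i, F.mulVec v (coordEquiv p (.inr (i, 0)))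
      = -(b i * v (coordEquiv p (.inr (i, 1)))) := by
    intro v i
    rw [hmul]
    simp [Matrix.mulVec, dotProduct, splitMatrix, Fintype.sum_prod_type]
  have hy : ∀ v i, F.mulVec v (coordEquiv p (.inr (i, 1)))
      = b i * v (coordEquiv p (.inr (i, 0))) := by
    intro v i
    rw [hmul]
    simp [Matrix.mulVec, dotProduct, splitMatrix, Fintype.sum_prod_type]
  have hker : ∀ v, v ∈ LinearMap.ker F.mulVecLin ↔
      v (coordEquiv p (.inl 1)) = -v (coordEquiv p (.inl 0)) ∧ v (coordEquiv p (.inl 2)) = 0 ∧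
      ∀ i, v (coordEquiv p (.inr (i, 0))) = 0 ∧ v (coordEquiv p (.inr (i, 1))) = 0 := by
    intro v
    rw [LinearMap.mem_ker, Matrix.mulVecLin_apply]
    constructor
    · intro h
      refine ⟨?_, ?_, fun i => ⟨?_, ?_⟩⟩
      · have := h2 v
        simp only [h, Pi.zero_apply, zero_eq_mul, hc0, false_or] at this
        linarith
      · simpa [h, hc0] using h0 v
      · simpa [h, hb i] using hy v i
      · simpa [h, hb i] using hx v i
    · rintro ⟨h, h', h''⟩
      ext k
      obtain ⟨k, rfl⟩ := (coordEquiv p).surjective k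
      rcases k with k | ⟨i, k⟩ <;> fin_cases k
      · simp [h0, h']
      · simp [h1, h']
      · simp [h2, h]
      · simp [h3]
      · simp [hx, h'' i]
      · simp [hy, h'' i]
  have hmem : ((Pi.single 0 1 : Fin (2 * p + 2 + 2) → ℝ) - Pi.single 1 1)
      ∈ LinearMap.ker F.mulVecLin := by
    rw [LinearMap.mem_ker, Matrix.mulVecLin_apply, Matrix.mulVec_sub, hF0, hF1, sub_self]
  refine ⟨?_, ?_, ?_, hmem, ?_, ?_, ?_, ?_⟩
  · intro u v
    simp only [mink_coordEquiv, h0, h1, h2, h3, hx, hy]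
    have hs : ∀ s t : ℝ, s + t = 0 → ∀ q r : ℝ, q + r = 0 → (q + s) + (r + t) = 0 := by
      intros; linarith
    apply hs
    · rw [← Finset.sum_add_distrib]
      exact Finset.sum_eq_zero fun i _ => by ring
    · ring
  · ext v
    rw [Submodule.mem_span_pair, hker]
    simp only [← coordEquiv_inl_zero p, ← coordEquiv_inl_one p, ← coordEquiv_inl_three p hp]
    constructor
    · rintro ⟨h, h', h''⟩
      refine ⟨v (coordEquiv p (.inl 0)), v (coordEquiv p (.inl 3)), ?_⟩
      ext k
      obtain ⟨k, rfl⟩ := (coordEquiv p).surjective k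
      rcases k with k | ⟨i, k⟩ <;> fin_cases k <;> simp [h, h', h'']
    · rintro ⟨x, y, rfl⟩
      simp
  · intro v hv
    obtain ⟨h, h', h''⟩ := (hker v).1 hv
    simp only [mink_coordEquiv, h, h', h'']
    simp [mul_self_nonneg]
  · intro h
    have := congrFun h 0
    simp at this
  · simp only [mink_coordEquiv, ← coordEquiv_inl_zero p, ← coordEquiv_inl_one p]
    simp
  · intro w hw
    obtain ⟨h, h', h''⟩ := (hker w).1 hw
    simp only [mink_coordEquiv, ← coordEquiv_inl_zero p, ← coordEquiv_inl_one p]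
    simp [h]
  · rw [← charpoly_neg_splitMatrix_sq c b, ← hF, Matrix.submatrix_mul_equiv,
      ← Matrix.charpoly_reindex (coordEquiv p).symm]
    rfl
end
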